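/- arXiv:2006.05672 — 8 statements merged into one kernel-verified Lean document; each statement's English description precedes it below -/
import Mathlib

section
/- Let Ω ⊆ ℝ² be open and let ρ, u₁, u₂ : Ω → ℝ be C² with ρ > 0 on Ω. Suppose that the continuity equation ∂₁(ρu₁) + ∂₂(ρu₂) = 0 holds and that the vorticity-to-density ratio is transported along the flow: u₁∂₁(ω/ρ) + u₂∂₂(ω/ρ) = 0, where ω = ∂₁u₂ − ∂₂u₁. Then the planar vector field (u₁∂₁u₁ + u₂∂₂u₁ + ∂₁h(ρ), u₁∂₁u₂ + u₂∂₂u₂ + ∂₂h(ρ)) is curl-free on Ω, i.e. ∂₂(u₁∂₁u₁ + u₂∂₂u₁ + ∂₁h(ρ)) − ∂₁(u₁∂₁u₂ + u₂∂₂u₂ + ∂₂h(ρ)) = 0 on Ω. -/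
open Set

/-- Partial derivative in the first coordinate direction. -/
noncomputable def pd1 (f : ℝ × ℝ → ℝ) (x : ℝ × ℝ) : ℝ := fderiv ℝ f x (1, 0)

/-- Partial derivative in the second coordinate direction. -/
noncomputable def pd2 (f : ℝ × ℝ → ℝ) (x : ℝ × ℝ) : ℝ := fderiv ℝ f x (0, 1)

/-- The enthalpy `h(ϱ) = ϱ^(γ-1)/(γ-1)`. -/
noncomputable def enth (γ ϱ : ℝ) : ℝ := ϱ ^ (γ - 1) / (γ - 1)

theorem aux_contDiffAt_fd {f : ℝ × ℝ → ℝ} {x : ℝ × ℝ} (hf : ContDiffAt ℝ 2 f x) :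
    DifferentiableAt ℝ (fderiv ℝ f) x :=
  (hf.fderiv_right (m := 1) (by norm_num)).differentiableAt (by norm_num)

theorem aux_d1 {f : ℝ × ℝ → ℝ} {x : ℝ × ℝ} (hf : ContDiffAt ℝ 2 f x) :
    DifferentiableAt ℝ (pd1 f) x :=
  (aux_contDiffAt_fd hf).clm_apply (differentiableAt_const ((1 : ℝ), (0 : ℝ)))

theorem aux_d2 {f : ℝ × ℝ → ℝ} {x : ℝ × ℝ} (hf : ContDiffAt ℝ 2 f x) :
    DifferentiableAt ℝ (pd2 f) x :=
  (aux_contDiffAt_fd hf).clm_apply (differentiableAt_const ((0 : ℝ), (1 : ℝ)))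

theorem aux_fd {f : ℝ × ℝ → ℝ} {x v w : ℝ × ℝ} (hf : ContDiffAt ℝ 2 f x) :
    fderiv ℝ (fun y => fderiv ℝ f y v) x w = fderiv ℝ (fderiv ℝ f) x w v := by
  rw [fderiv_clm_apply (aux_contDiffAt_fd hf) (differentiableAt_const v)]
  simp

theorem aux_symm {f : ℝ × ℝ → ℝ} {x : ℝ × ℝ} (hf : ContDiffAt ℝ 2 f x) :
    pd2 (pd1 f) x = pd1 (pd2 f) x := by
  have h := (hf.isSymmSndFDerivAt (by simp)).eq (0, 1) (1, 0)
  have e1 := aux_fd (v := (1, 0)) (w := (0, 1)) hf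
  have e2 := aux_fd (v := (0, 1)) (w := (1, 0)) hf
  exact e1.trans (h.trans e2.symm)

theorem aux_add1 {f g : ℝ × ℝ → ℝ} {x : ℝ × ℝ} (hf : DifferentiableAt ℝ f x)
    (hg : DifferentiableAt ℝ g x) : pd1 (fun y => f y + g y) x = pd1 f x + pd1 g x := by
  simp only [pd1]
  rw [fderiv_fun_add hf hg]; rfl

theorem aux_sub1 {f g : ℝ × ℝ → ℝ} {x : ℝ × ℝ} (hf : DifferentiableAt ℝ f x)
    (hg : DifferentiableAt ℝ g x) : pd1 (fun y => f y - g y) x = pd1 f x - pd1 g x := by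
  simp only [pd1]
  rw [fderiv_fun_sub hf hg]; rfl

theorem aux_mul1 {f g : ℝ × ℝ → ℝ} {x : ℝ × ℝ} (hf : DifferentiableAt ℝ f x)
    (hg : DifferentiableAt ℝ g x) :
    pd1 (fun y => f y * g y) x = f x * pd1 g x + g x * pd1 f x := by
  simp only [pd1]
  rw [fderiv_fun_mul hf hg]; rfl

theorem aux_div1 {f g : ℝ × ℝ → ℝ} {x : ℝ × ℝ} (hf : DifferentiableAt ℝ f x)
    (hg : DifferentiableAt ℝ g x) (h0 : ∀ᶠ y in nhds x, g y ≠ 0) :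
    pd1 f x = f x / g x * pd1 g x + g x * pd1 (fun y => f y / g y) x := by
  have hq : DifferentiableAt ℝ (fun y => f y / g y) x := by
    have := hf.fun_mul (hg.fun_inv h0.self_of_nhds)
    simpa only [div_eq_mul_inv] using this
  rw [← aux_mul1 hq hg]
  have : f =ᶠ[nhds x] fun y => f y / g y * g y := by
    filter_upwards [h0] with y hy
    field_simp
  simp only [pd1]
  rw [this.fderiv_eq]

theorem aux_add2 {f g : ℝ × ℝ → ℝ} {x : ℝ × ℝ} (hf : DifferentiableAt ℝ f x)
    (hg : DifferentiableAt ℝ g x) : pd2 (fun y => f y + g y) x = pd2 f x + pd2 g x := by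
  simp only [pd2]
  rw [fderiv_fun_add hf hg]; rfl

theorem aux_sub2 {f g : ℝ × ℝ → ℝ} {x : ℝ × ℝ} (hf : DifferentiableAt ℝ f x)
    (hg : DifferentiableAt ℝ g x) : pd2 (fun y => f y - g y) x = pd2 f x - pd2 g x := by
  simp only [pd2]
  rw [fderiv_fun_sub hf hg]; rfl

theorem aux_mul2 {f g : ℝ × ℝ → ℝ} {x : ℝ × ℝ} (hf : DifferentiableAt ℝ f x)
    (hg : DifferentiableAt ℝ g x) :
    pd2 (fun y => f y * g y) x = f x * pd2 g x + g x * pd2 f x := by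
  simp only [pd2]
  rw [fderiv_fun_mul hf hg]; rfl

theorem aux_div2 {f g : ℝ × ℝ → ℝ} {x : ℝ × ℝ} (hf : DifferentiableAt ℝ f x)
    (hg : DifferentiableAt ℝ g x) (h0 : ∀ᶠ y in nhds x, g y ≠ 0) :
    pd2 f x = f x / g x * pd2 g x + g x * pd2 (fun y => f y / g y) x := by
  have hq : DifferentiableAt ℝ (fun y => f y / g y) x := by
    have := hf.fun_mul (hg.fun_inv h0.self_of_nhds)
    simpa only [div_eq_mul_inv] using this
  rw [← aux_mul2 hq hg]
  have : f =ᶠ[nhds x] fun y => f y / g y * g y := by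
    filter_upwards [h0] with y hy
    field_simp
  simp only [pd2]
  rw [this.fderiv_eq]

/-- If `ρ, u₁, u₂` are `C²` with `ρ > 0` on an open set `Ω ⊆ ℝ²`, the continuity equation
holds and the vorticity-to-density ratio `ω/ρ` (with `ω = ∂₁u₂ − ∂₂u₁`) is transported
along the flow, then the vector field
`(u₁∂₁u₁ + u₂∂₂u₁ + ∂₁h(ρ), u₁∂₁u₂ + u₂∂₂u₂ + ∂₂h(ρ))` is curl-free on `Ω`. -/
theorem euler_momentum_field_curl_free
    (γ : ℝ) (hγ : 1 < γ)
    (Ω : Set (ℝ × ℝ)) (hΩ : IsOpen Ω)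
    (ρ u₁ u₂ : ℝ × ℝ → ℝ)
    (hρ : ContDiffOn ℝ 2 ρ Ω) (hu₁ : ContDiffOn ℝ 2 u₁ Ω) (hu₂ : ContDiffOn ℝ 2 u₂ Ω)
    (hρpos : ∀ x ∈ Ω, 0 < ρ x)
    (hcont : ∀ x ∈ Ω,
      pd1 (fun y => ρ y * u₁ y) x + pd2 (fun y => ρ y * u₂ y) x = 0)
    (htransport : ∀ x ∈ Ω,
      u₁ x * pd1 (fun y => (pd1 u₂ y - pd2 u₁ y) / ρ y) x
        + u₂ x * pd2 (fun y => (pd1 u₂ y - pd2 u₁ y) / ρ y) x = 0) :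
    ∀ x ∈ Ω,
      pd2 (fun y => u₁ y * pd1 u₁ y + u₂ y * pd2 u₁ y + pd1 (fun w => enth γ (ρ w)) y) x
        - pd1 (fun y => u₁ y * pd1 u₂ y + u₂ y * pd2 u₂ y + pd2 (fun w => enth γ (ρ w)) y) x
        = 0 := by
  intro x hx
  have hN := hΩ.mem_nhds hx
  have cρ := hρ.contDiffAt hN
  have c1 := hu₁.contDiffAt hN
  have c2 := hu₂.contDiffAt hN
  have dρ : DifferentiableAt ℝ ρ x := cρ.differentiableAt (by norm_num)
  have d1 : DifferentiableAt ℝ u₁ x := c1.differentiableAt (by norm_num)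
  have d2 : DifferentiableAt ℝ u₂ x := c2.differentiableAt (by norm_num)
  have hpos := hρpos x hx
  have ch : ContDiffAt ℝ 2 (fun w => enth γ (ρ w)) x := by
    unfold enth
    exact (cρ.rpow_const_of_ne hpos.ne').div_const _
  have h0 : ∀ᶠ y in nhds x, ρ y ≠ 0 := by
    filter_upwards [hN] with y hy
    exact (hρpos y hy).ne'
  have hc := hcont x hx
  have ht := htransport x hx
  rw [aux_mul1 dρ d1, aux_mul2 dρ d2] at hc
  have dω : DifferentiableAt ℝ (fun y => pd1 u₂ y - pd2 u₁ y) x := (aux_d1 c2).fun_sub (aux_d2 c1)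
  have q1 := aux_div1 dω dρ h0
  have q2 := aux_div2 dω dρ h0
  rw [aux_sub1 (aux_d1 c2) (aux_d2 c1)] at q1
  rw [aux_sub2 (aux_d1 c2) (aux_d2 c1)] at q2
  rw [aux_add2 ((d1.fun_mul (aux_d1 c1)).fun_add (d2.fun_mul (aux_d2 c1))) (aux_d1 ch),
    aux_add2 (d1.fun_mul (aux_d1 c1)) (d2.fun_mul (aux_d2 c1)),
    aux_add1 ((d1.fun_mul (aux_d1 c2)).fun_add (d2.fun_mul (aux_d2 c2))) (aux_d2 ch),
    aux_add1 (d1.fun_mul (aux_d1 c2)) (d2.fun_mul (aux_d2 c2)),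
    aux_mul2 d1 (aux_d1 c1), aux_mul2 d2 (aux_d2 c1),
    aux_mul1 d1 (aux_d1 c2), aux_mul1 d2 (aux_d2 c2),
    aux_symm ch, aux_symm c1]
  rw [aux_symm c2] at q2
  have hW : (pd1 u₂ x - pd2 u₁ x) / ρ x * ρ x = pd1 u₂ x - pd2 u₁ x := by field_simp
  generalize (pd1 u₂ x - pd2 u₁ x) / ρ x = W at *
  linear_combination (-u₁ x) * q1 - u₂ x * q2 - ρ x * ht - W * hc +
    (pd1 u₁ x + pd2 u₂ x) * hW
end

section
/- Fix γ > 1 and B > 0, and define F(ϱ) = 2ϱ²(B − h(ϱ)). Then for every t ∈ [0, 𝔱_c(B)) there exists a unique ϱ(t) ∈ (ϱ_c(B), ϱ*(B)] such that F(ϱ(t)) = t. Moreover the map t ↦ ϱ(t) is continuous and strictly decreasing on [0, 𝔱_c(B)), it is differentiable on (0, 𝔱_c(B)) with ϱ′(t) = ϱ(t)/(2(t − ϱ(t)^{γ+1})) < 0, and as t → 𝔱_c(B)⁻ one has ϱ(t) → ϱ_c(B) and ϱ′(t) → −∞. -/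
open Set Filter

/-- The critical density `ϱ_c(s) = (2(γ-1)s/(γ+1))^(1/(γ-1))`. -/
noncomputable def rhoCrit (γ s : ℝ) : ℝ := (2 * (γ - 1) / (γ + 1) * s) ^ (1 / (γ - 1))

/-- The maximum density `ϱ*(s) = ((γ-1)s)^(1/(γ-1))`. -/
noncomputable def rhoMax (γ s : ℝ) : ℝ := ((γ - 1) * s) ^ (1 / (γ - 1))

/-- The square of the critical momentum `𝔱_c(s) = (2(γ-1)s/(γ+1))^((γ+1)/(γ-1))`. -/
noncomputable def tCrit (γ s : ℝ) : ℝ := (2 * (γ - 1) / (γ + 1) * s) ^ ((γ + 1) / (γ - 1))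

lemma branch_abstract (F F' : ℝ → ℝ) (c M T : ℝ) (hcM : c < M)
    (hFc : F c = T) (hFM : F M = 0)
    (hd : ∀ r, c ≤ r → HasDerivAt F (F' r) r)
    (hneg : ∀ r, c < r → F' r < 0) (hc0 : F' c = 0) (hcont : ContinuousAt F' c) :
    ∃ ρ : ℝ → ℝ,
      (∀ t ∈ Ico (0:ℝ) T, ρ t ∈ Ioc c M ∧ F (ρ t) = t ∧
        (∀ r ∈ Ioc c M, F r = t → r = ρ t)) ∧
      ContinuousOn ρ (Ico (0:ℝ) T) ∧
      StrictAntiOn ρ (Ico (0:ℝ) T) ∧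
      (∀ t ∈ Ioo (0:ℝ) T, HasDerivAt ρ (F' (ρ t))⁻¹ t) ∧
      Tendsto ρ (nhdsWithin T (Iio T)) (nhds c) ∧
      Tendsto (deriv ρ) (nhdsWithin T (Iio T)) atBot := by
  have hFcont : ContinuousOn F (Icc c M) := fun r hr =>
    (hd r hr.1).continuousAt.continuousWithinAt
  have hanti : StrictAntiOn F (Icc c M) := by
    apply strictAntiOn_of_deriv_neg (convex_Icc c M) hFcont
    intro x hx
    rw [interior_Icc] at hx
    rw [(hd x hx.1.le).deriv]
    exact hneg x hx.1
  have hT : 0 < T := by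
    rw [← hFc, ← hFM]
    exact hanti (left_mem_Icc.2 hcM.le) (right_mem_Icc.2 hcM.le) hcM
  have hmaps : ∀ r ∈ Icc c M, F r ∈ Icc 0 T := by
    intro r hr
    constructor
    · rw [← hFM]; exact hanti.antitoneOn hr (right_mem_Icc.2 hcM.le) hr.2
    · rw [← hFc]; exact hanti.antitoneOn (left_mem_Icc.2 hcM.le) hr hr.1
  let f : Icc c M → Icc 0 T := fun r => ⟨F r, hmaps r r.2⟩
  have hfc : Continuous f := by
    apply Continuous.subtype_mk
    exact hFcont.restrict
  have hbij : Function.Bijective f := by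
    constructor
    · intro a b hab
      apply Subtype.ext
      exact hanti.injOn a.2 b.2 (congrArg Subtype.val hab)
    · intro t
      have := intermediate_value_Icc' hcM.le hFcont
      rw [hFc, hFM] at this
      obtain ⟨r, hr, hrt⟩ := this t.2
      exact ⟨⟨r, hr⟩, Subtype.ext hrt⟩
  let e := Equiv.ofBijective f hbij
  have hec : Continuous e.symm := Continuous.continuous_symm_of_equiv_compact_to_t2 (f := e) hfc
  let ρ : ℝ → ℝ := fun t => (e.symm (projIcc 0 T hT.le t) : ℝ)
  have hρc : Continuous ρ :=
    continuous_subtype_val.comp (hec.comp continuous_projIcc)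
  have hρmem : ∀ t, ρ t ∈ Icc c M := fun t => (e.symm (projIcc 0 T hT.le t)).2
  have hFρ : ∀ t ∈ Icc 0 T, F (ρ t) = t := by
    intro t ht
    have h1 : e (e.symm (projIcc 0 T hT.le t)) = projIcc 0 T hT.le t := e.apply_symm_apply _
    have h2 : F (ρ t) = projIcc 0 T hT.le t := congrArg Subtype.val h1
    rw [h2, projIcc_of_mem hT.le ht]
  have hρT : ρ T = c :=
    hanti.injOn (hρmem T) (left_mem_Icc.2 hcM.le)
      ((hFρ T (right_mem_Icc.2 hT.le)).trans hFc.symm)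
  have hρgt : ∀ t ∈ Ico 0 T, c < ρ t := by
    intro t ht
    refine lt_of_le_of_ne (hρmem t).1 ?_
    intro h
    have := hFρ t ⟨ht.1, ht.2.le⟩
    rw [← h, hFc] at this
    exact absurd this ht.2.ne'
  have hder : ∀ t ∈ Ioo (0:ℝ) T, HasDerivAt ρ (F' (ρ t))⁻¹ t := by
    intro t ht
    apply HasDerivAt.of_local_left_inverse hρc.continuousAt (hd _ (hρmem t).1)
      (hneg _ (hρgt t ⟨ht.1.le, ht.2⟩)).ne
    filter_upwards [Icc_mem_nhds ht.1 ht.2] with y hy using hFρ y hy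
  have hlim : Tendsto ρ (nhdsWithin T (Iio T)) (nhds c) := by
    have := (hρc.tendsto T).mono_left (nhdsWithin_le_nhds (s := Iio T))
    rwa [hρT] at this
  have hev : ∀ᶠ t in nhdsWithin T (Iio T), t ∈ Ioo 0 T := Ioo_mem_nhdsLT hT
  refine ⟨ρ, ?_, hρc.continuousOn, ?_, hder, hlim, ?_⟩
  · intro t ht
    have htt : t ∈ Icc 0 T := ⟨ht.1, ht.2.le⟩
    refine ⟨⟨hρgt t ht, (hρmem t).2⟩, hFρ t htt, ?_⟩
    intro r hr hrt
    exact hanti.injOn ⟨hr.1.le, hr.2⟩ (hρmem t) (hrt.trans (hFρ t htt).symm)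
  · intro a ha b hb hab
    rw [← hanti.lt_iff_gt (hρmem a) (hρmem b)]
    rwa [hFρ a ⟨ha.1, ha.2.le⟩, hFρ b ⟨hb.1, hb.2.le⟩]
  · have h1 : Tendsto (fun t => F' (ρ t)) (nhdsWithin T (Iio T)) (nhdsWithin 0 (Iio 0)) := by
      apply tendsto_nhdsWithin_of_tendsto_nhds_of_eventually_within
      · rw [← hc0]; exact hcont.tendsto.comp hlim
      · filter_upwards [hev] with t ht using hneg _ (hρgt t ⟨ht.1.le, ht.2⟩)
    have h2 := tendsto_inv_nhdsLT_zero.comp h1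
    refine h2.congr' ?_
    filter_upwards [hev] with t ht
    exact (hder t ht).deriv.symm

/-- The subsonic branch of densities: for `F(ϱ) = 2ϱ²(B − h(ϱ))` and every
`t ∈ [0, 𝔱_c(B))` there is a unique `ϱ(t) ∈ (ϱ_c(B), ϱ*(B)]` with `F(ϱ(t)) = t`; the map
`t ↦ ϱ(t)` is continuous and strictly decreasing, differentiable on `(0, 𝔱_c(B))` with
`ϱ′(t) = ϱ(t)/(2(t − ϱ(t)^(γ+1))) < 0`, and as `t → 𝔱_c(B)⁻` one has
`ϱ(t) → ϱ_c(B)` and `ϱ′(t) → −∞`. -/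
theorem subsonic_branch_of_densities
    (γ B : ℝ) (hγ : 1 < γ) (hB : 0 < B) :
    ∃ ρ : ℝ → ℝ,
      (∀ t ∈ Ico (0:ℝ) (tCrit γ B),
        ρ t ∈ Ioc (rhoCrit γ B) (rhoMax γ B) ∧
        2 * ρ t ^ 2 * (B - enth γ (ρ t)) = t ∧
        (∀ r ∈ Ioc (rhoCrit γ B) (rhoMax γ B),
          2 * r ^ 2 * (B - enth γ r) = t → r = ρ t)) ∧
      ContinuousOn ρ (Ico (0:ℝ) (tCrit γ B)) ∧
      StrictAntiOn ρ (Ico (0:ℝ) (tCrit γ B)) ∧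
      (∀ t ∈ Ioo (0:ℝ) (tCrit γ B),
        HasDerivAt ρ (ρ t / (2 * (t - ρ t ^ (γ + 1)))) t ∧
        ρ t / (2 * (t - ρ t ^ (γ + 1))) < 0) ∧
      Tendsto ρ (nhdsWithin (tCrit γ B) (Iio (tCrit γ B))) (nhds (rhoCrit γ B)) ∧
      Tendsto (deriv ρ) (nhdsWithin (tCrit γ B) (Iio (tCrit γ B))) atBot := by
  have hk : 0 < γ - 1 := by linarith
  have hk1 : 0 < γ + 1 := by linarith
  have hbase : 0 < 2 * (γ - 1) / (γ + 1) * B := by positivity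
  have hc : 0 < rhoCrit γ B := Real.rpow_pos_of_pos hbase _
  have hcpow : rhoCrit γ B ^ (γ - 1) = 2 * (γ - 1) / (γ + 1) * B := by
    unfold rhoCrit
    rw [← Real.rpow_mul hbase.le, one_div, inv_mul_cancel₀ hk.ne', Real.rpow_one]
  have hMbase : 0 < (γ - 1) * B := by positivity
  have hMpow : rhoMax γ B ^ (γ - 1) = (γ - 1) * B := by
    unfold rhoMax
    rw [← Real.rpow_mul hMbase.le, one_div, inv_mul_cancel₀ hk.ne', Real.rpow_one]
  have hcM : rhoCrit γ B < rhoMax γ B := by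
    apply Real.rpow_lt_rpow hbase.le _ (by positivity)
    have : 2 * (γ - 1) / (γ + 1) < γ - 1 := by
      rw [div_lt_iff₀ hk1]; nlinarith
    exact mul_lt_mul_of_pos_right this hB
  have hTc : tCrit γ B = rhoCrit γ B ^ (γ + 1) := by
    unfold tCrit rhoCrit
    rw [← Real.rpow_mul hbase.le]
    congr 1
    field_simp
  have hpow1 : ∀ r : ℝ, 0 < r → r ^ (γ + 1) = r ^ 2 * r ^ (γ - 1) := by
    intro r hr
    rw [← Real.rpow_natCast, ← Real.rpow_add hr]
    congr 1
    push_cast; ring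
  have hpow2 : ∀ r : ℝ, 0 < r → r * r ^ (γ - 1 - 1) = r ^ (γ - 1) := by
    intro r hr
    nth_rewrite 1 [← Real.rpow_one r]
    rw [← Real.rpow_add hr]
    congr 1
    ring
  obtain ⟨ρ, h1, h2, h3, h4, h5, h6⟩ := branch_abstract
    (fun r => 2 * r ^ 2 * (B - enth γ r))
    (fun r => 2 * (γ + 1) / (γ - 1) * r * (rhoCrit γ B ^ (γ - 1) - r ^ (γ - 1)))
    (rhoCrit γ B) (rhoMax γ B) (tCrit γ B) hcM
    (by
      simp only [enth]
      rw [hTc, hpow1 _ hc, hcpow]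
      field_simp
      ring)
    (by
      simp only [enth]
      rw [hMpow]
      field_simp
      simp)
    (by
      intro r hr
      have hr0 : 0 < r := hc.trans_le hr
      have hh : HasDerivAt (enth γ) ((γ - 1) * r ^ (γ - 1 - 1) / (γ - 1)) r :=
        (Real.hasDerivAt_rpow_const (Or.inl hr0.ne')).div_const _
      have := (((hasDerivAt_id r).pow 2).const_mul 2).mul (hh.const_sub B)
      refine this.congr_deriv ?_
      have e := hpow2 r hr0
      rw [hcpow]
      simp only [enth, id, Pi.pow_apply]
      rw [← e]
      field_simp
      push_cast
      ring)
    (by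
      intro r hr
      have hr0 : 0 < r := hc.trans hr
      have := Real.rpow_lt_rpow hc.le hr hk
      exact mul_neg_of_pos_of_neg (by positivity) (by linarith))
    (by simp)
    (by
      have : ContinuousAt (fun r : ℝ => r ^ (γ - 1)) (rhoCrit γ B) :=
        Real.continuousAt_rpow_const _ _ (Or.inl hc.ne')
      fun_prop)
  refine ⟨ρ, h1, h2, h3, ?_, h5, h6⟩
  intro t ht
  obtain ⟨⟨hlt, hle⟩, hF, -⟩ := h1 t ⟨ht.1.le, ht.2⟩
  have hr0 : 0 < ρ t := hc.trans hlt
  have hD := h4 t ht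
  have hpl := Real.rpow_lt_rpow hc.le hlt hk
  have key : t - ρ t ^ (γ + 1) =
      (γ + 1) / (γ - 1) * ρ t ^ 2 * (rhoCrit γ B ^ (γ - 1) - ρ t ^ (γ - 1)) := by
    rw [hpow1 _ hr0, hcpow]
    simp only [enth] at hF
    rw [← sub_eq_zero] at hF ⊢
    rw [← neg_eq_zero, ← hF]
    field_simp
    ring
  have hne : rhoCrit γ B ^ (γ - 1) - ρ t ^ (γ - 1) < 0 := by linarith
  have hneg : t - ρ t ^ (γ + 1) < 0 := by
    rw [key]
    exact mul_neg_of_pos_of_neg (by positivity) hne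
  refine ⟨hD.congr_deriv ?_, div_neg_of_pos_of_neg hr0 (by linarith)⟩
  rw [key]
  have := hne.ne
  field_simp
end

section
/- Fix γ > 1 and H̄ > 0. Let B : [0, H̄] → ℝ be continuous with B₊ := min B > 0 and B⁺ := max B, and assume B⁺ − B₊ < ((γ−1)/2)·B₊ (which guarantees ϱ_c(B⁺) < ϱ*(B₊)). Define 𝒬(ϱ) = ∫₀^{H̄} ϱ·√(2(B(x) − h(ϱ))) dx for ϱ ∈ [ϱ_c(B⁺), ϱ*(B₊)]. Then 𝒬 is continuous and strictly decreasing on [ϱ_c(B⁺), ϱ*(B₊)]; consequently, for every Q with 𝒬(ϱ*(B₊)) < Q < 𝒬(ϱ_c(B⁺)) there exists a unique ϱ̄ ∈ (ϱ_c(B⁺), ϱ*(B₊)) such that 𝒬(ϱ̄) = Q. -/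
open Set

lemma enth_cont (γ : ℝ) (hγ : 1 < γ) : Continuous (enth γ) := by
  unfold enth
  exact (Real.continuous_rpow_const (by linarith)).div_const _

lemma rhoCrit_pos (γ s : ℝ) (hγ : 1 < γ) (hs : 0 < s) : 0 < rhoCrit γ s := by
  unfold rhoCrit
  have : 0 < γ - 1 := by linarith
  have : 0 < γ + 1 := by linarith
  positivity

lemma sq_anti (γ b s t : ℝ) (hγ : 1 < γ) (hs : 0 < s) (hb : b ≤ s) :
    StrictAntiOn (fun r : ℝ => r ^ 2 * (2 * (b - enth γ r))) (Icc (rhoCrit γ s) t) := by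
  have hg : 0 < γ - 1 := by linarith
  apply strictAntiOn_of_deriv_neg (convex_Icc _ _)
  · have := enth_cont γ hγ
    fun_prop
  · intro r hr
    rw [interior_Icc] at hr
    have hc := rhoCrit_pos γ s hγ hs
    have hr0 : 0 < r := hc.trans hr.1
    have h1 : HasDerivAt (enth γ) ((γ - 1) * r ^ (γ - 1 - 1) / (γ - 1)) r := by
      unfold enth
      exact (Real.hasDerivAt_rpow_const (Or.inl hr0.ne')).div_const _
    have h2 : HasDerivAt (fun r : ℝ => r ^ 2 * (2 * (b - enth γ r))) _ r :=
      (hasDerivAt_pow 2 r).mul ((h1.const_sub b).const_mul 2)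
    rw [h2.deriv]
    have h3 : 2 * (γ - 1) / (γ + 1) * s < r ^ (γ - 1) := by
      have h := Real.rpow_lt_rpow hc.le hr.1 hg
      unfold rhoCrit at h
      rwa [← Real.rpow_mul (by have : 0 < γ + 1 := by linarith
                               positivity), one_div_mul_cancel hg.ne', Real.rpow_one] at h
    have h4 : r ^ (γ - 1 - 1) = r ^ (γ - 1) / r := by
      rw [Real.rpow_sub_one hr0.ne']
    rw [h4]
    unfold enth
    set p := r ^ (γ - 1)
    have h5 : s < (γ + 1) * p / (2 * (γ - 1)) := by
      rw [lt_div_iff₀ (by positivity)]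
      rw [div_mul_eq_mul_div, div_lt_iff₀ (by linarith)] at h3
      linarith
    have h6 : 4 * r * (b - (γ + 1) * p / (2 * (γ - 1))) < 0 :=
      mul_neg_of_pos_of_neg (by positivity) (by linarith)
    convert h6 using 1
    field_simp
    ring

lemma enth_le (γ s r : ℝ) (hγ : 1 < γ) (hs : 0 < s) (hr : 0 < r) (h : r ≤ rhoMax γ s) :
    enth γ r ≤ s := by
  have hg : 0 < γ - 1 := by linarith
  have h := Real.rpow_le_rpow hr.le h hg.le
  unfold rhoMax at h
  rw [← Real.rpow_mul (by positivity), one_div_mul_cancel hg.ne', Real.rpow_one] at h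
  unfold enth
  rw [div_le_iff₀ hg]
  linarith

lemma pt_anti (γ b m s : ℝ) (hγ : 1 < γ) (hm : 0 < m) (hmb : m ≤ b) (hb : b ≤ s) :
    StrictAntiOn (fun r : ℝ => r * Real.sqrt (2 * (b - enth γ r)))
      (Icc (rhoCrit γ s) (rhoMax γ m)) := by
  have hc := rhoCrit_pos γ s hγ (by linarith)
  have key : ∀ r ∈ Icc (rhoCrit γ s) (rhoMax γ m),
      r * Real.sqrt (2 * (b - enth γ r)) = Real.sqrt (r ^ 2 * (2 * (b - enth γ r))) := by
    intro r hr
    rw [Real.sqrt_mul (sq_nonneg r), Real.sqrt_sq (hc.le.trans hr.1)]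
  intro x hx y hy hxy
  have h := sq_anti γ b s (rhoMax γ m) hγ (by linarith) hb hx hy hxy
  simp only [key x hx, key y hy] at h ⊢
  apply Real.sqrt_lt_sqrt _ h
  have := enth_le γ m y hγ hm (hc.trans_le hy.1) hy.2
  have : 0 ≤ b - enth γ y := by linarith
  positivity

/-- The upstream mass flux `𝒬(ϱ) = ∫₀^H̄ ϱ √(2(B(x) − h(ϱ))) dx` is continuous and
strictly decreasing on `[ϱ_c(B⁺), ϱ*(B₊)]` (where `B₊ = min B > 0`, `B⁺ = max B` and
`B⁺ − B₊ < ((γ−1)/2)B₊`); hence for every `Q` strictly between the two extreme fluxes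
there is a unique `ϱb ∈ (ϱ_c(B⁺), ϱ*(B₊))` with `𝒬(ϱb) = Q`. -/
theorem upstream_flux_strictly_decreasing
    (γ H : ℝ) (hγ : 1 < γ) (hH : 0 < H)
    (B : ℝ → ℝ) (hBcont : ContinuousOn B (Icc 0 H))
    (Bmin Bmax : ℝ)
    (hmin : IsLeast (B '' Icc 0 H) Bmin)
    (hmax : IsGreatest (B '' Icc 0 H) Bmax)
    (hBpos : 0 < Bmin)
    (hgap : Bmax - Bmin < (γ - 1) / 2 * Bmin) :
    let 𝒬 : ℝ → ℝ := fun ϱ => ∫ x in (0:ℝ)..H, ϱ * Real.sqrt (2 * (B x - enth γ ϱ))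
    ContinuousOn 𝒬 (Icc (rhoCrit γ Bmax) (rhoMax γ Bmin)) ∧
    StrictAntiOn 𝒬 (Icc (rhoCrit γ Bmax) (rhoMax γ Bmin)) ∧
    ∀ Q : ℝ, 𝒬 (rhoMax γ Bmin) < Q → Q < 𝒬 (rhoCrit γ Bmax) →
      ∃! ϱb : ℝ, ϱb ∈ Ioo (rhoCrit γ Bmax) (rhoMax γ Bmin) ∧ 𝒬 ϱb = Q := by
  intro 𝒬
  have hbd : ∀ x ∈ Icc 0 H, Bmin ≤ B x ∧ B x ≤ Bmax := fun x hx =>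
    ⟨hmin.2 (mem_image_of_mem _ hx), hmax.2 (mem_image_of_mem _ hx)⟩
  have hmM : Bmin ≤ Bmax := (hbd 0 ⟨le_rfl, hH.le⟩).1.trans (hbd 0 ⟨le_rfl, hH.le⟩).2
  have hcont : Continuous 𝒬 := by
    have hB' : Continuous (IccExtend hH.le ((Icc 0 H).domRestrict B)) :=
      (continuousOn_iff_continuous_domRestrict.1 hBcont).Icc_extend'
    have he := enth_cont γ hγ
    have h1 : Continuous fun ϱ : ℝ => ∫ x in (0:ℝ)..H,
        ϱ * Real.sqrt (2 * (IccExtend hH.le ((Icc 0 H).domRestrict B) x - enth γ ϱ)) := by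
      apply intervalIntegral.continuous_parametric_intervalIntegral_of_continuous'
      simp only [Function.uncurry_def]
      fun_prop
    convert h1 using 2 with ϱ
    apply intervalIntegral.integral_congr
    intro x hx
    rw [uIcc_of_le hH.le] at hx
    simp only [IccExtend_of_mem hH.le _ hx]
    rfl
  have hanti : StrictAntiOn 𝒬 (Icc (rhoCrit γ Bmax) (rhoMax γ Bmin)) := by
    intro x hx y hy hxy
    have hc : ∀ r : ℝ, ContinuousOn (fun t => r * Real.sqrt (2 * (B t - enth γ r))) (Icc 0 H) := by
      intro r
      fun_prop
    have hp : ∀ t ∈ Icc 0 H, y * Real.sqrt (2 * (B t - enth γ y)) <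
        x * Real.sqrt (2 * (B t - enth γ x)) := fun t ht =>
      pt_anti γ (B t) Bmin Bmax hγ hBpos (hbd t ht).1 (hbd t ht).2 hx hy hxy
    exact intervalIntegral.integral_lt_integral_of_continuousOn_of_le_of_exists_lt hH (hc y) (hc x)
      (fun t ht => (hp t (Ioc_subset_Icc_self ht)).le) ⟨0, ⟨le_rfl, hH.le⟩, hp 0 ⟨le_rfl, hH.le⟩⟩
  refine ⟨hcont.continuousOn, hanti, ?_⟩
  intro Q h1 h2
  have hle : rhoCrit γ Bmax ≤ rhoMax γ Bmin := by
    unfold rhoCrit rhoMax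
    have hg : 0 < γ - 1 := by linarith
    have hM : 0 < Bmax := by linarith
    have hg1 : 0 < γ + 1 := by linarith
    apply Real.rpow_le_rpow (by positivity) _ (by positivity)
    rw [div_mul_eq_mul_div, div_le_iff₀ hg1]
    nlinarith
  obtain ⟨r, hr, hrQ⟩ := intermediate_value_Ioo' hle hcont.continuousOn ⟨h1, h2⟩
  refine ⟨r, ⟨hr, hrQ⟩, ?_⟩
  rintro r' ⟨hr', hrQ'⟩
  exact hanti.injOn (Ioo_subset_Icc_self hr') (Ioo_subset_Icc_self hr) (hrQ'.trans hrQ.symm)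
end

section
/- Fix γ > 1, B₊ > 0 and H̄ > 1. There exist constants κ̄ > 0 and C > 0, depending only on γ, B₊ and H̄, with the following property. Let B ∈ C^{1,1}([0, H̄]) satisfy min B = B₊, B′(0) = B′(H̄) = 0 and sup|B′| + Lip(B′) =: κ ≤ κ̄, and set B⁺ := max B, Q* := ∫₀^{H̄} ϱ_c(B⁺)√(2(B(x) − h(ϱ_c(B⁺)))) dx. Then κ^{1/4} < Q*, ∫₀^{H̄} ϱ*(B₊)√(2(B(x) − h(ϱ*(B₊)))) dx ≤ κ^{1/4}, and for every Q ∈ (κ^{1/4}, Q*) the unique ϱ̄ ∈ (ϱ_c(B⁺), ϱ*(B₊)) with ∫₀^{H̄} ϱ̄√(2(B(x) − h(ϱ̄))) dx = Q satisfies ϱ_c(B⁺) ≤ ϱ̄ ≤ ϱ*(B₊) − C^{−1}κ^{1/2}; moreover the upstream horizontal velocity ū(x) := √(2(B(x) − h(ϱ̄))) satisfies ū′(0) = ū′(H̄) = 0, C^{−1}κ^{1/4} ≤ ū(x) ≤ C for all x ∈ [0, H̄], and sup|ū′| + Lip(ū′) ≤ C·κ^{3/4}. -/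
open Set

theorem aux_enth_rpow {γ z : ℝ} (hγ : 1 < γ) (hz : 0 ≤ z) :
    enth γ (z ^ (1 / (γ - 1))) = z / (γ - 1) := by
  have : γ - 1 ≠ 0 := by linarith
  unfold enth
  rw [← Real.rpow_mul hz, one_div_mul_cancel this, Real.rpow_one]

theorem aux_enth_max {γ s : ℝ} (hγ : 1 < γ) (hs : 0 < s) : enth γ (rhoMax γ s) = s := by
  have h1 : 0 < γ - 1 := by linarith
  unfold rhoMax
  rw [aux_enth_rpow hγ (by positivity)]
  field_simp

theorem aux_enth_crit {γ s : ℝ} (hγ : 1 < γ) (hs : 0 < s) :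
    enth γ (rhoCrit γ s) = 2 * s / (γ + 1) := by
  have h1 : 0 < γ - 1 := by linarith
  have h2 : 0 < γ + 1 := by linarith
  unfold rhoCrit
  rw [aux_enth_rpow hγ (by positivity)]
  field_simp

theorem aux_enth_mono {γ x y : ℝ} (hγ : 1 < γ) (hx : 0 ≤ x) (hxy : x ≤ y) :
    enth γ x ≤ enth γ y := by
  have h1 : 0 < γ - 1 := by linarith
  unfold enth
  gcongr

theorem aux_enth_strict {γ x y : ℝ} (hγ : 1 < γ) (hx : 0 ≤ x) (hxy : x < y) :
    enth γ x < enth γ y := by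
  have h1 : 0 < γ - 1 := by linarith
  unfold enth
  gcongr

theorem aux_crit_mono {γ x y : ℝ} (hγ : 1 < γ) (hx : 0 ≤ x) (hxy : x ≤ y) :
    rhoCrit γ x ≤ rhoCrit γ y := by
  have h1 : 0 < γ - 1 := by linarith
  have h2 : 0 < γ + 1 := by linarith
  unfold rhoCrit
  gcongr

theorem aux_lip {γ m M : ℝ} (hγ : 1 < γ) (hm : 0 < m) :
    ∃ L : ℝ, 0 < L ∧ ∀ x y, m ≤ x → x ≤ y → y ≤ M → enth γ y - enth γ x ≤ L * (y - x) := by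
  have h1 : 0 < γ - 1 := by linarith
  have hc : ContinuousOn (fun x : ℝ => x ^ (γ - 1 - 1)) (Icc m M) := by
    intro x hx
    exact (Real.continuousAt_rpow_const x _ (Or.inl (by linarith [hx.1]))).continuousWithinAt
  obtain ⟨L, hL⟩ := isCompact_Icc.exists_bound_of_continuousOn hc
  refine ⟨|L| + 1, by positivity, ?_⟩
  intro x y hx hxy hy
  have hd : ∀ z ∈ Icc m M, HasDerivWithinAt (enth γ) (z ^ (γ - 1 - 1)) (Icc m M) z := by
    intro z hz
    have hz0 : z ≠ 0 := by linarith [hz.1]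
    have := (Real.hasDerivAt_rpow_const (x := z) (p := γ - 1) (Or.inl hz0)).div_const (γ - 1)
    have h3 : (γ - 1) * z ^ (γ - 1 - 1) / (γ - 1) = z ^ (γ - 1 - 1) := by field_simp
    rw [h3] at this
    exact this.hasDerivWithinAt
  have := (convex_Icc m M).norm_image_sub_le_of_norm_hasDerivWithin_le (C := |L| + 1) hd
    (fun z hz => (hL z hz).trans (by linarith [le_abs_self L]))
    (x := x) (y := y) ⟨hx, hxy.trans hy⟩ ⟨hx.trans hxy, hy⟩
  rw [Real.norm_eq_abs, Real.norm_eq_abs, abs_of_nonneg (sub_nonneg.2 hxy)] at this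
  exact (le_abs_self _).trans this

theorem aux_cont {γ H : ℝ} (hγ : 1 < γ) (hH : 0 ≤ H) {B : ℝ → ℝ}
    (hB : ContinuousOn B (Icc 0 H)) :
    Continuous (fun r : ℝ => ∫ x in (0:ℝ)..H, r * Real.sqrt (2 * (B x - enth γ r))) := by
  have h1 : 0 < γ - 1 := by linarith
  have he : Continuous (enth γ) := by
    unfold enth
    exact (Real.continuous_rpow_const h1.le).div_const _
  have hE : Continuous (IccExtend hH ((Icc 0 H).domRestrict B)) :=
    (continuousOn_iff_continuous_domRestrict.1 hB).Icc_extend'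
  have heq : (fun r : ℝ => ∫ x in (0:ℝ)..H, r * Real.sqrt (2 * (B x - enth γ r))) =
      fun r : ℝ => ∫ x in (0:ℝ)..H,
        r * Real.sqrt (2 * (IccExtend hH ((Icc 0 H).domRestrict B) x - enth γ r)) := by
    funext r
    apply intervalIntegral.integral_congr
    intro x hx
    rw [uIcc_of_le hH] at hx
    simp only [IccExtend_of_mem hH _ hx, domRestrict_apply]
  rw [heq]
  apply intervalIntegral.continuous_parametric_intervalIntegral_of_continuous'
  fun_prop

theorem aux_intble {γ H r : ℝ} (hH : 0 ≤ H) {B : ℝ → ℝ}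
    (hB : ContinuousOn B (Icc 0 H)) :
    IntervalIntegrable (fun x => r * Real.sqrt (2 * (B x - enth γ r))) MeasureTheory.volume 0 H := by
  apply ContinuousOn.intervalIntegrable
  rw [uIcc_of_le hH]
  fun_prop

theorem aux_int_le {γ H r a : ℝ} (hH : 0 ≤ H) (hr : 0 ≤ r) {B : ℝ → ℝ}
    (hB : ContinuousOn B (Icc 0 H)) (ha : ∀ x ∈ Icc 0 H, 2 * (B x - enth γ r) ≤ a) :
    (∫ x in (0:ℝ)..H, r * Real.sqrt (2 * (B x - enth γ r))) ≤ H * (r * Real.sqrt a) := by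
  have := intervalIntegral.integral_mono_on hH (aux_intble (γ := γ) (r := r) hH hB)
    (intervalIntegrable_const (c := r * Real.sqrt a)) (fun x hx => by
      have := ha x hx
      gcongr)
  rw [intervalIntegral.integral_const, sub_zero, smul_eq_mul] at this
  exact this

theorem aux_le_int {γ H r a : ℝ} (hH : 0 ≤ H) (hr : 0 ≤ r) {B : ℝ → ℝ}
    (hB : ContinuousOn B (Icc 0 H)) (ha : ∀ x ∈ Icc 0 H, a ≤ 2 * (B x - enth γ r)) :
    H * (r * Real.sqrt a) ≤ (∫ x in (0:ℝ)..H, r * Real.sqrt (2 * (B x - enth γ r))) := by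
  have := intervalIntegral.integral_mono_on hH 
    (intervalIntegrable_const (c := r * Real.sqrt a)) (aux_intble (γ := γ) (r := r) hH hB)
    (fun x hx => by
      have := ha x hx
      gcongr)
  rw [intervalIntegral.integral_const, sub_zero, smul_eq_mul] at this
  exact this

/-- velocity estimates -/
theorem aux_vel {H κ t c e : ℝ} (hH : 0 < H) (hc : 0 < c) (ht : 0 < t) (ht1 : t ≤ 1)
    (hκ : κ = t ^ 4) {B B' : ℝ → ℝ}
    (hd : ∀ x ∈ Icc (0:ℝ) H, HasDerivWithinAt B (B' x) (Icc (0:ℝ) H) x)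
    (hb : ∀ x ∈ Icc (0:ℝ) H, |B' x| ≤ κ)
    (hl : ∀ x ∈ Icc (0:ℝ) H, ∀ y ∈ Icc (0:ℝ) H, |B' x - B' y| ≤ κ * |x - y|)
    (hBl : ∀ x ∈ Icc (0:ℝ) H, ∀ y ∈ Icc (0:ℝ) H, |B x - B y| ≤ κ * |x - y|)
    (he : ∀ x ∈ Icc (0:ℝ) H, (c * t) ^ 2 ≤ 2 * (B x - e)) (u : ℝ → ℝ)
    (hu : u = fun x => Real.sqrt (2 * (B x - e))) :
    (∀ x ∈ Icc (0:ℝ) H, c * t ≤ u x) ∧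
    (∀ x ∈ Icc (0:ℝ) H, HasDerivWithinAt u (B' x / u x) (Icc (0:ℝ) H) x) ∧
    (∀ x ∈ Icc (0:ℝ) H, |B' x / u x| ≤ c⁻¹ * t ^ 3) ∧
    (∀ x ∈ Icc (0:ℝ) H, ∀ y ∈ Icc (0:ℝ) H,
      |B' x / u x - B' y / u y| ≤ (c⁻¹ + (c⁻¹) ^ 3) * t ^ 3 * |x - y|) := by
  have hlow : ∀ x ∈ Icc (0:ℝ) H, c * t ≤ u x := by
    intro x hx
    rw [hu]
    exact Real.le_sqrt_of_sq_le (he x hx)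
  have hct : 0 < c * t := by positivity
  have hup : ∀ x ∈ Icc (0:ℝ) H, 0 < u x := fun x hx => hct.trans_le (hlow x hx)
  have hsq : ∀ x ∈ Icc (0:ℝ) H, u x ^ 2 = 2 * (B x - e) := by
    intro x hx
    rw [hu]
    exact Real.sq_sqrt (le_trans (by positivity) (he x hx))
  have hinv : ∀ x ∈ Icc (0:ℝ) H, (u x)⁻¹ ≤ c⁻¹ * t⁻¹ := by
    intro x hx
    rw [← mul_inv]
    exact inv_anti₀ hct (hlow x hx)
  refine ⟨hlow, ?_, ?_, ?_⟩
  · intro x hx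
    have hpos : 2 * (B x - e) ≠ 0 := by rw [← hsq x hx]; exact (pow_pos (hup x hx) 2).ne'
    have h := (((hd x hx).sub_const e).const_mul 2).sqrt hpos
    have h2 : B' x / u x = 2 * B' x / (2 * Real.sqrt (2 * (B x - e))) := by
      rw [hu, mul_div_mul_left _ _ two_ne_zero]
    rw [h2, hu]
    exact h
  · intro x hx
    rw [div_eq_mul_inv, abs_mul, abs_of_pos (inv_pos.2 (hup x hx))]
    calc |B' x| * (u x)⁻¹ ≤ κ * (c⁻¹ * t⁻¹) := by
          have := hinv x hx
          have := hb x hx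
          have := hup x hx
          gcongr
          exact (abs_nonneg _).trans (hb x hx)
      _ = c⁻¹ * t ^ 3 := by rw [hκ]; field_simp
  · intro x hx y hy
    have hux := hup x hx
    have huy := hup y hy
    have hκ0 : 0 ≤ κ := by rw [hκ]; positivity
    have hdu : |u y - u x| ≤ κ * |x - y| * (c⁻¹ * t⁻¹) := by
      have h1 : u y - u x = (2 * (B y - B x)) * (u x + u y)⁻¹ := by
        have := hsq x hx
        have := hsq y hy
        field_simp
        nlinarith
      have h2 : (u x + u y)⁻¹ ≤ 2⁻¹ * (c⁻¹ * t⁻¹) := by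
        rw [← mul_inv, ← mul_inv]
        apply inv_anti₀ (by positivity)
        linarith [hlow x hx, hlow y hy]
      rw [h1, abs_mul, abs_mul, abs_of_pos (inv_pos.2 (add_pos hux huy)), abs_two]
      have h3 := hBl y hy x hx
      rw [abs_sub_comm y x] at h3
      calc 2 * |B y - B x| * (u x + u y)⁻¹ ≤ 2 * (κ * |x - y|) * (2⁻¹ * (c⁻¹ * t⁻¹)) := by
            gcongr
        _ = _ := by ring
    have key : B' x / u x - B' y / u y
        = (B' x - B' y) * (u x)⁻¹ + B' y * (u y - u x) * ((u x)⁻¹ * (u y)⁻¹) := by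
      field_simp
      ring
    rw [key]
    calc |(B' x - B' y) * (u x)⁻¹ + B' y * (u y - u x) * ((u x)⁻¹ * (u y)⁻¹)|
        ≤ |B' x - B' y| * (u x)⁻¹ + |B' y| * |u y - u x| * ((u x)⁻¹ * (u y)⁻¹) := by
          refine (abs_add_le _ _).trans (le_of_eq ?_)
          rw [abs_mul, abs_mul, abs_mul, abs_of_pos (inv_pos.2 hux),
            abs_of_pos (mul_pos (inv_pos.2 hux) (inv_pos.2 huy))]
      _ ≤ (κ * |x - y|) * (c⁻¹ * t⁻¹) + κ * (κ * |x - y| * (c⁻¹ * t⁻¹)) *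
            ((c⁻¹ * t⁻¹) * (c⁻¹ * t⁻¹)) := by
          have h1 := hinv x hx
          have h2 := hinv y hy
          have h3 := hl x hx y hy
          have h4 := hb y hy
          gcongr
      _ = (c⁻¹ * t ^ 3 + (c⁻¹) ^ 3 * (t ^ 3 * (t * t))) * |x - y| := by
          rw [hκ]; field_simp
      _ ≤ (c⁻¹ + (c⁻¹) ^ 3) * t ^ 3 * |x - y| := by
          have : t * t ≤ 1 := by nlinarith
          have : t ^ 3 * (t * t) ≤ t ^ 3 * 1 := by gcongr
          rw [add_mul c⁻¹]
          gcongr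
          linarith

set_option maxHeartbeats 1000000

/-- Quantitative properties of the upstream state: for `γ > 1`, `B₊ > 0`, `H̄ > 1` there
are constants `κ̄, C > 0` depending only on these data such that for every `C^{1,1}`
Bernoulli function `B` with `min B = B₊`, `B′(0) = B′(H̄) = 0` and `C^{0,1}`-norm of `B′`
equal to `κ ∈ (0, κ̄]`, one has `κ^{1/4} < Q*`, the flux of the state with density
`ϱ*(B₊)` is at most `κ^{1/4}`, and for every flux `Q ∈ (κ^{1/4}, Q*)` the (unique)
upstream density `ϱ̄ ∈ (ϱ_c(B⁺), ϱ*(B₊))` with flux `Q` satisfies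
`ϱ_c(B⁺) ≤ ϱ̄ ≤ ϱ*(B₊) − C⁻¹κ^{1/2}`, and the upstream velocity
`ū(x) = √(2(B(x) − h(ϱ̄)))` satisfies `ū′(0) = ū′(H̄) = 0`,
`C⁻¹κ^{1/4} ≤ ū ≤ C` and `‖ū′‖_{C^{0,1}} ≤ Cκ^{3/4}`. -/
theorem upstream_state_estimates
    (γ Bmin H : ℝ) (hγ : 1 < γ) (hBmin : 0 < Bmin) (hH : 1 < H) :
    ∃ κbar C : ℝ, 0 < κbar ∧ 0 < C ∧
      ∀ (B B' : ℝ → ℝ) (κ : ℝ),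
        (∀ x ∈ Icc (0:ℝ) H, HasDerivWithinAt B (B' x) (Icc (0:ℝ) H) x) →
        IsLeast (B '' Icc (0:ℝ) H) Bmin →
        B' 0 = 0 → B' H = 0 →
        0 < κ → κ ≤ κbar →
        (∀ x ∈ Icc (0:ℝ) H, |B' x| ≤ κ) →
        (∀ x ∈ Icc (0:ℝ) H, ∀ y ∈ Icc (0:ℝ) H, |B' x - B' y| ≤ κ * |x - y|) →
        ∀ Bmax : ℝ, IsGreatest (B '' Icc (0:ℝ) H) Bmax →
        let Qstar : ℝ := ∫ x in (0:ℝ)..H,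
          rhoCrit γ Bmax * Real.sqrt (2 * (B x - enth γ (rhoCrit γ Bmax)))
        κ ^ ((1:ℝ)/4) < Qstar ∧
        (∫ x in (0:ℝ)..H,
            rhoMax γ Bmin * Real.sqrt (2 * (B x - enth γ (rhoMax γ Bmin))))
          ≤ κ ^ ((1:ℝ)/4) ∧
        ∀ Q ∈ Ioo (κ ^ ((1:ℝ)/4)) Qstar,
          (∃ ϱb ∈ Ioo (rhoCrit γ Bmax) (rhoMax γ Bmin),
            (∫ x in (0:ℝ)..H, ϱb * Real.sqrt (2 * (B x - enth γ ϱb))) = Q) ∧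
          ∀ ϱb ∈ Ioo (rhoCrit γ Bmax) (rhoMax γ Bmin),
            (∫ x in (0:ℝ)..H, ϱb * Real.sqrt (2 * (B x - enth γ ϱb))) = Q →
            rhoCrit γ Bmax ≤ ϱb ∧ ϱb ≤ rhoMax γ Bmin - C⁻¹ * κ ^ ((1:ℝ)/2) ∧
            (let ubar : ℝ → ℝ := fun x => Real.sqrt (2 * (B x - enth γ ϱb))
             HasDerivWithinAt ubar 0 (Icc (0:ℝ) H) 0 ∧
             HasDerivWithinAt ubar 0 (Icc (0:ℝ) H) H ∧
             (∀ x ∈ Icc (0:ℝ) H, C⁻¹ * κ ^ ((1:ℝ)/4) ≤ ubar x ∧ ubar x ≤ C) ∧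
             (∀ x ∈ Icc (0:ℝ) H,
               |derivWithin ubar (Icc (0:ℝ) H) x| ≤ C * κ ^ ((3:ℝ)/4)) ∧
             (∀ x ∈ Icc (0:ℝ) H, ∀ y ∈ Icc (0:ℝ) H,
               |derivWithin ubar (Icc (0:ℝ) H) x - derivWithin ubar (Icc (0:ℝ) H) y|
                 ≤ C * κ ^ ((3:ℝ)/4) * |x - y|)) := by
  have hγ1 : 0 < γ - 1 := by linarith
  have hγ2 : 0 < γ + 1 := by linarith
  have hH0 : 0 < H := by linarith
  obtain ⟨R, hR⟩ : ∃ R, R = rhoMax γ Bmin := ⟨_, rfl⟩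
  have hR0 : 0 < R := by rw [hR]; unfold rhoMax; positivity
  obtain ⟨m, hm⟩ : ∃ m, m = rhoCrit γ Bmin := ⟨_, rfl⟩
  have hm0 : 0 < m := by rw [hm]; unfold rhoCrit; positivity
  obtain ⟨L, hL0, hL⟩ := aux_lip (M := R) hγ hm0
  obtain ⟨q, hq⟩ : ∃ q, q = H * (m * Real.sqrt ((γ - 1) * Bmin / (γ + 1))) := ⟨_, rfl⟩
  have hq0 : 0 < q := by rw [hq]; positivity
  obtain ⟨c, hc⟩ : ∃ c, c = 1 / (2 * H * R) := ⟨_, rfl⟩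
  have hc0 : 0 < c := by rw [hc]; positivity
  obtain ⟨T, hT0, hT1, hT2, hT3, hT4⟩ : ∃ T : ℝ, 0 < T ∧ T ≤ 1 ∧ T * (4 * H) ≤ (γ - 1) * Bmin ∧
      T < q ∧ T * (4 * H ^ 3 * R ^ 2) ≤ 1 := by
    refine ⟨min 1 (min ((γ - 1) * Bmin / (4 * H)) (min (q / 2) (1 / (4 * H ^ 3 * R ^ 2)))),
      by positivity, min_le_left _ _, ?_, ?_, ?_⟩
    · rw [← le_div_iff₀ (by positivity)]
      exact (min_le_right _ _).trans (min_le_left _ _)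
    · refine lt_of_le_of_lt ((min_le_right _ _).trans
        ((min_le_right _ _).trans (min_le_left _ _))) (by linarith)
    · rw [← le_div_iff₀ (by positivity)]
      exact (min_le_right _ _).trans ((min_le_right _ _).trans (min_le_right _ _))
  obtain ⟨C, hC⟩ : ∃ C, C = (c⁻¹ + c⁻¹ ^ 3) + L / c ^ 2 + (2 * (Bmin + H) + 1) := ⟨_, rfl⟩
  have e1 : 0 < c⁻¹ := by positivity
  have e2 : 0 < c⁻¹ ^ 3 := by positivity
  have e3 : 0 < L / c ^ 2 := by positivity
  have hC0 : 0 < C := by rw [hC]; positivity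
  have hCc : C⁻¹ ≤ c := by
    rw [inv_le_comm₀ hC0 hc0]; linarith
  have hCL : C⁻¹ * L ≤ c ^ 2 := by
    rw [inv_mul_le_iff₀ hC0, ← div_le_iff₀ (by positivity)]; linarith
  refine ⟨T ^ 4, C, by positivity, hC0, ?_⟩
  intro B B' κ hd hmin hB0 hBH hκ0 hκT hb hl Bmax hmax
  obtain ⟨t, ht⟩ : ∃ t, t = κ ^ ((1:ℝ)/4) := ⟨_, rfl⟩
  have ht0 : 0 < t := by rw [ht]; positivity
  have hκ : κ = t ^ 4 := by
    rw [ht, ← Real.rpow_natCast, ← Real.rpow_mul hκ0.le]; norm_num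
  have hκ2 : κ ^ ((1:ℝ)/2) = t ^ 2 := by
    rw [ht, ← Real.rpow_natCast, ← Real.rpow_mul hκ0.le]; norm_num
  have hκ3 : κ ^ ((3:ℝ)/4) = t ^ 3 := by
    rw [ht, ← Real.rpow_natCast, ← Real.rpow_mul hκ0.le]; norm_num
  have htT : t ≤ T := by
    rw [hκ] at hκT
    exact le_of_pow_le_pow_left₀ (by norm_num) hT0.le hκT
  have ht1 : t ≤ 1 := htT.trans hT1
  have hBl : ∀ x ∈ Icc (0:ℝ) H, ∀ y ∈ Icc (0:ℝ) H, |B x - B y| ≤ κ * |x - y| := by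
    intro x hx y hy
    exact (convex_Icc (0:ℝ) H).norm_image_sub_le_of_norm_hasDerivWithin_le hd hb hy hx
  have hcont : ContinuousOn B (Icc 0 H) := fun x hx => (hd x hx).continuousWithinAt
  have hlo : ∀ x ∈ Icc (0:ℝ) H, Bmin ≤ B x := fun x hx => hmin.2 ⟨x, hx, rfl⟩
  have hhi : ∀ x ∈ Icc (0:ℝ) H, B x ≤ Bmin + κ * H := by
    obtain ⟨y, hy, hyB⟩ := hmin.1
    intro x hx
    have h1 := (le_abs_self _).trans (hBl x hx y hy)
    have h2 : |x - y| ≤ H := by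
      rw [abs_le]; constructor <;> linarith [hx.1, hx.2, hy.1, hy.2]
    have h3 : κ * |x - y| ≤ κ * H := by gcongr
    linarith
  have hMhi : Bmax ≤ Bmin + κ * H := by
    obtain ⟨y, hy, hyB⟩ := hmax.1
    rw [← hyB]; exact hhi y hy
  have hMlo : Bmin ≤ Bmax := hmax.2 hmin.1
  have hM0 : 0 < Bmax := by linarith
  have ht2 : t ^ 2 ≤ t := by nlinarith
  have ht4 : t ^ 4 ≤ t ^ 2 := by nlinarith
  have hκH : κ * (4 * H) ≤ (γ - 1) * Bmin := by
    refine le_trans ?_ hT2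
    gcongr
    rw [hκ]; linarith
  have hκR : t ^ 2 * (4 * H ^ 3 * R ^ 2) ≤ 1 := by
    refine le_trans ?_ hT4
    gcongr
    linarith
  have hec := aux_enth_crit hγ hM0
  have heM := aux_enth_max hγ hBmin
  have hcrit0 : 0 < rhoCrit γ Bmax := by unfold rhoCrit; positivity
  have hmc : m ≤ rhoCrit γ Bmax := by rw [hm]; exact aux_crit_mono hγ hBmin.le hMlo
  have hgap : (γ - 1) * Bmin / (γ + 1) ≤ 2 * (Bmin - enth γ (rhoCrit γ Bmax)) := by
    rw [hec, div_le_iff₀ hγ2]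
    have : 2 * (Bmin - 2 * Bmax / (γ + 1)) * (γ + 1) = 2 * (Bmin * (γ + 1) - 2 * Bmax) := by
      field_simp
    rw [this]
    nlinarith
  have hcM : rhoCrit γ Bmax ≤ R := by
    by_contra hcon
    push Not at hcon
    have h1 := aux_enth_strict hγ hR0.le hcon
    rw [hR, heM] at h1
    have : 0 < (γ - 1) * Bmin / (γ + 1) := by positivity
    linarith
  rw [← hR] at heM
  have hQ : t < ∫ x in (0:ℝ)..H,
          rhoCrit γ Bmax * Real.sqrt (2 * (B x - enth γ (rhoCrit γ Bmax))) := by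
    have h1 := aux_le_int (γ := γ) hH0.le hcrit0.le hcont
      (a := (γ - 1) * Bmin / (γ + 1)) (fun x hx => by linarith [hlo x hx])
    have h2 : q ≤ H * (rhoCrit γ Bmax * Real.sqrt ((γ - 1) * Bmin / (γ + 1))) := by
      rw [hq]; gcongr
    linarith
  have hsm : (∫ x in (0:ℝ)..H, R * Real.sqrt (2 * (B x - enth γ R))) ≤ t := by
    have h1 := aux_int_le (γ := γ) hH0.le hR0.le hcont
      (a := 2 * (κ * H)) (fun x hx => by rw [heM]; linarith [hhi x hx])
    refine h1.trans ?_
    refine le_of_pow_le_pow_left₀ (n := 2) (by norm_num) ht0.le ?_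
    rw [mul_pow, mul_pow, Real.sq_sqrt (by positivity), hκ]
    have h3 : H ^ 2 * (R ^ 2 * (2 * (t ^ 4 * H))) = t ^ 2 * ((t ^ 2 * (4 * H ^ 3 * R ^ 2)) / 2) := by
      ring
    rw [h3]
    have h4 : t ^ 2 * ((t ^ 2 * (4 * H ^ 3 * R ^ 2)) / 2) ≤ t ^ 2 * (1 / 2) := by gcongr
    have : 0 < t ^ 2 := by positivity
    linarith
  simp only [← ht, ← hR, hκ2, hκ3]
  refine ⟨hQ, hsm, ?_⟩
  intro Q hQm
  refine ⟨?_, ?_⟩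
  · have := intermediate_value_Ioo' hcM (aux_cont hγ hH0.le hcont).continuousOn
    obtain ⟨r, hr, hrQ⟩ := this ⟨hsm.trans_lt hQm.1, hQm.2⟩
    exact ⟨r, hr, hrQ⟩
  · intro r hr hrQ
    have hr0 : 0 < r := hcrit0.trans hr.1
    have hδ0 : enth γ r < Bmin := by
      rw [← heM]; exact aux_enth_strict hγ hr0.le hr.2
    have hepos : 0 ≤ enth γ r := by unfold enth; positivity
    have hδ : (c * t) ^ 2 ≤ Bmin - enth γ r := by
      have h1 := aux_int_le (γ := γ) hH0.le hr0.le hcont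
        (a := 2 * (Bmin - enth γ r + κ * H)) (fun x hx => by linarith [hhi x hx])
      rw [hrQ] at h1
      have hnn : 0 ≤ 2 * (Bmin - enth γ r + κ * H) := by
        have : 0 < κ * H := by positivity
        linarith
      have h2 : t ≤ H * (R * Real.sqrt (2 * (Bmin - enth γ r + κ * H))) := by
        refine hQm.1.le.trans (h1.trans ?_)
        have := hr.2.le
        gcongr
      have h3 : t ^ 2 ≤ H ^ 2 * (R ^ 2 * (2 * (Bmin - enth γ r + κ * H))) := by
        rw [← Real.sq_sqrt hnn, ← mul_pow, ← mul_pow]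
        gcongr
      have h4 : (c * t) ^ 2 = t ^ 2 / (4 * H ^ 2 * R ^ 2) := by
        rw [hc]; field_simp; ring
      rw [h4, div_le_iff₀ (by positivity)]
      have h5 : H ^ 2 * (R ^ 2 * (2 * (κ * H))) = t ^ 2 * ((t ^ 2 * (4 * H ^ 3 * R ^ 2)) / 2) := by
        rw [hκ]; ring
      have h6 : t ^ 2 * ((t ^ 2 * (4 * H ^ 3 * R ^ 2)) / 2) ≤ t ^ 2 * (1 / 2) := by gcongr
      have h7 : H ^ 2 * (R ^ 2 * (2 * (Bmin - enth γ r + κ * H))) =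
          (Bmin - enth γ r) * (4 * H ^ 2 * R ^ 2) / 2 + H ^ 2 * (R ^ 2 * (2 * (κ * H))) := by ring
      linarith
    obtain ⟨v1, v2, v3, v4⟩ := aux_vel (e := enth γ r) hH0 hc0 ht0 ht1 hκ hd hb hl hBl
      (fun x hx => by
        have := hlo x hx
        have : 0 ≤ (c * t) ^ 2 := by positivity
        linarith) _ rfl
    have z0 : (0:ℝ) ∈ Icc 0 H := ⟨le_rfl, hH0.le⟩
    have zH : H ∈ Icc 0 H := ⟨hH0.le, le_rfl⟩
    have hdw := fun x (hx : x ∈ Icc (0:ℝ) H) =>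
      (v2 x hx).derivWithin (uniqueDiffOn_Icc hH0 x hx)
    refine ⟨hr.1.le, ?_, ?_, ?_, ?_, ?_, ?_⟩
    · have h1 := hL r R (hmc.trans hr.1.le) hr.2.le le_rfl
      rw [heM] at h1
      have h2 : C⁻¹ * L * t ^ 2 ≤ c ^ 2 * t ^ 2 := by gcongr
      have h3 : L * (C⁻¹ * t ^ 2) ≤ L * (R - r) := by
        rw [mul_pow] at hδ; linarith
      have := le_of_mul_le_mul_left h3 hL0
      linarith
    · have := v2 0 z0
      rwa [hB0, zero_div] at this
    · have := v2 H zH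
      rwa [hBH, zero_div] at this
    · intro x hx
      constructor
      · refine le_trans ?_ (v1 x hx)
        gcongr
      · have h1 := hhi x hx
        have h2 : κ * H ≤ 1 * H := by
          gcongr; rw [hκ]; linarith
        have h3 : (1:ℝ) ≤ 2 * (Bmin + H) + 1 := by linarith
        apply Real.sqrt_le_iff.2 ⟨hC0.le, ?_⟩
        have h4 : 2 * (B x - enth γ r) ≤ C := by linarith
        have h5 : 1 ≤ C := by linarith
        nlinarith
    · intro x hx
      rw [hdw x hx]
      refine (v3 x hx).trans ?_
      gcongr
      linarith
    · intro x hx y hy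
      rw [hdw x hx, hdw y hy]
      refine (v4 x hx y hy).trans ?_
      gcongr
      linarith
end

section
/- Fix γ > 1 and Q ∈ ℝ, and let 𝓑 : ℝ → (0,∞) be C¹. Let S = {(t,z) ∈ ℝ² : 0 ≤ t < 𝔱_c(𝓑(z))}, let U ⊆ ℝ² be open with S ⊆ U, and let ρ : U → (0,∞) be C¹ such that for every (t,z) ∈ S one has ϱ_c(𝓑(z)) < ρ(t,z) ≤ ϱ*(𝓑(z)) and 2ρ(t,z)²(𝓑(z) − h(ρ(t,z))) = t. Define G(t,z) := (1/2)∫₀ᵗ (1/ρ(τ,z)) dτ + (1/γ)(ρ(0,z)^γ − ρ(0,Q)^γ) for (t,z) ∈ S. Then for every (t,z) ∈ S, the partial derivative in z exists and satisfies ∂_z G(t,z) = 𝓑′(z)·ρ(t,z). -/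
open Set

theorem aux_deriv (γ : ℝ) (hγ : 1 < γ) (r b T : ℝ → ℝ) (r' b' T' x : ℝ)
    (hr : HasDerivAt r r' x) (hb : HasDerivAt b b' x) (hT : HasDerivAt T T' x)
    (hpos : 0 < r x)
    (hE : (fun y => 2 * r y ^ 2 * (b y - enth γ (r y))) =ᶠ[nhds x] T) :
    HasDerivAt (fun y => 2 * b y * r y - (γ + 1) / (γ * (γ - 1)) * r y ^ γ)
      (b' * r x + T' / (2 * r x)) x := by
  have h1 : γ - 1 ≠ 0 := by linarith
  have h2 : γ ≠ 0 := by linarith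
  have e1 : r x ^ (γ - 1) = r x ^ (γ - 1 - 1) * r x := by
    rw [Real.rpow_sub_one hpos.ne' (γ - 1)]; field_simp
  have d1 : HasDerivAt (fun y => r y ^ γ) _ x := hr.rpow_const (Or.inl hpos.ne')
  have d2 : HasDerivAt (fun y => r y ^ (γ - 1)) _ x := hr.rpow_const (Or.inl hpos.ne')
  have d3 : HasDerivAt (fun y => 2 * r y ^ 2 * (b y - enth γ (r y))) _ x :=
    ((hr.pow 2).const_mul 2).mul (hb.sub (d2.div_const (γ - 1)))
  have h3 := (hT.congr_of_eventuallyEq hE).unique d3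
  have d4 := ((hb.const_mul 2).mul hr).sub (d1.const_mul ((γ + 1) / (γ * (γ - 1))))
  refine d4.congr_deriv ?_
  simp only [Pi.pow_apply, Nat.cast_ofNat] at h3
  simp only [enth] at h3
  rw [e1] at h3
  rw [h3, e1]
  have := hpos.ne'
  generalize r x ^ (γ - 1 - 1) = a
  field_simp
  ring

/-- Variational structure of the stream-function formulation: if `ρ(t,z)` is the
subsonic-branch density determined by the Bernoulli law
`2ρ(t,z)²(𝓑(z) − h(ρ(t,z))) = t` on `S = {(t,z) : 0 ≤ t < 𝔱_c(𝓑(z))}`, then the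
Lagrangian density
`G(t,z) = (1/2)∫₀ᵗ dτ/ρ(τ,z) + (1/γ)(ρ(0,z)^γ − ρ(0,Q)^γ)`
has a partial derivative in `z` satisfying `∂_zG(t,z) = 𝓑′(z)·ρ(t,z)` on `S`. -/
theorem lagrangian_z_derivative
    (γ Q : ℝ) (hγ : 1 < γ)
    (𝓑 : ℝ → ℝ) (h𝓑 : ContDiff ℝ 1 𝓑) (h𝓑pos : ∀ z, 0 < 𝓑 z)
    (S U : Set (ℝ × ℝ))
    (hS : S = {p : ℝ × ℝ | 0 ≤ p.1 ∧ p.1 < tCrit γ (𝓑 p.2)})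
    (hU : IsOpen U) (hSU : S ⊆ U)
    (ρ : ℝ × ℝ → ℝ) (hρ : ContDiffOn ℝ 1 ρ U) (hρpos : ∀ x ∈ U, 0 < ρ x)
    (hbranch : ∀ p ∈ S, rhoCrit γ (𝓑 p.2) < ρ p ∧ ρ p ≤ rhoMax γ (𝓑 p.2))
    (hbern : ∀ p ∈ S, 2 * ρ p ^ 2 * (𝓑 p.2 - enth γ (ρ p)) = p.1) :
    ∀ p ∈ S,
      HasDerivAt
        (fun z => (1/2) * (∫ τ in (0:ℝ)..p.1, 1 / ρ (τ, z)) +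
          (1/γ) * (ρ (0, z) ^ γ - ρ (0, Q) ^ γ))
        (deriv 𝓑 p.2 * ρ p) p.2 := by
  have hγ0 : (0:ℝ) < γ - 1 := by linarith
  have hdiff : ∀ q ∈ S, DifferentiableAt ℝ ρ q := fun q hq =>
    (hρ.differentiableOn one_ne_zero).differentiableAt (hU.mem_nhds (hSU hq))
  have hpos : ∀ q ∈ S, 0 < ρ q := fun q hq => hρpos q (hSU hq)
  -- closed form
  have key : ∀ t z, (t, z) ∈ S → (1/2) * (∫ τ in (0:ℝ)..t, 1 / ρ (τ, z)) +
      (1/γ) * (ρ (0, z) ^ γ - ρ (0, Q) ^ γ) =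
      (2 * 𝓑 z * ρ (t, z) - (γ + 1) / (γ * (γ - 1)) * ρ (t, z) ^ γ) - (1/γ) * ρ (0, Q) ^ γ := by
    intro t z htz
    have hm : 0 ≤ t ∧ t < tCrit γ (𝓑 z) := by rw [hS] at htz; exact htz
    have hsl : ∀ τ ∈ Icc 0 t, (τ, z) ∈ S := by
      intro τ hτ
      rw [hS]
      exact ⟨hτ.1, hτ.2.trans_lt hm.2⟩
    have hline : ∀ τ : ℝ, HasDerivAt (fun τ : ℝ => (τ, z)) ((1:ℝ), (0:ℝ)) τ := fun τ =>
      (hasDerivAt_id τ).prodMk (hasDerivAt_const τ z)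
    have hrd : ∀ τ ∈ Icc 0 t, HasDerivAt (fun τ => ρ (τ, z)) (fderiv ℝ ρ (τ, z) (1, 0)) τ :=
      fun τ hτ => (hdiff _ (hsl τ hτ)).hasFDerivAt.comp_hasDerivAt τ (hline τ)
    have hrc : ContinuousOn (fun τ => ρ (τ, z)) (Icc 0 t) :=
      fun τ hτ => (hrd τ hτ).continuousAt.continuousWithinAt
    have hint := intervalIntegral.integral_eq_sub_of_hasDerivAt_of_le
      (f := fun τ => 2 * 𝓑 z * ρ (τ, z) - (γ + 1) / (γ * (γ - 1)) * ρ (τ, z) ^ γ)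
      (f' := fun τ => (1/2) * (1 / ρ (τ, z))) hm.1
      ((continuousOn_const.mul hrc).sub (continuousOn_const.mul
        (hrc.rpow_const fun τ hτ => Or.inl (hpos _ (hsl τ hτ)).ne')))
      (by
        intro τ hτ
        have := aux_deriv γ hγ (fun τ => ρ (τ, z)) (fun _ => 𝓑 z) id _ 0 1 τ
          (hrd τ (Ioo_subset_Icc_self hτ)) (hasDerivAt_const _ _) (hasDerivAt_id τ)
          (hpos _ (hsl τ (Ioo_subset_Icc_self hτ)))
          (by
            filter_upwards [Ioo_mem_nhds hτ.1 hτ.2] with y hy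
            exact hbern _ (hsl y (Ioo_subset_Icc_self hy)))
        refine this.congr_deriv ?_
        have := (hpos _ (hsl τ (Ioo_subset_Icc_self hτ))).ne'
        field_simp
        ring)
      (by
        apply ContinuousOn.intervalIntegrable
        rw [uIcc_of_le hm.1]
        exact continuousOn_const.mul (continuousOn_const.div hrc
          fun τ hτ => (hpos _ (hsl τ hτ)).ne'))
    rw [intervalIntegral.integral_const_mul] at hint
    rw [hint]
    have h0 := hsl 0 ⟨le_rfl, hm.1⟩
    have hb0 := hbern _ h0
    have hp0 := hpos _ h0
    have hB : 𝓑 z = ρ (0, z) ^ (γ - 1) / (γ - 1) := by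
      have : 2 * ρ (0, z) ^ 2 ≠ 0 := by positivity
      have := (mul_eq_zero.1 hb0).resolve_left this
      simp only [enth] at this
      linarith
    have e : ρ (0, z) ^ γ = ρ (0, z) ^ (γ - 1) * ρ (0, z) := by
      rw [Real.rpow_sub_one hp0.ne']; field_simp
    have : 2 * 𝓑 z * ρ (0, z) - (γ + 1) / (γ * (γ - 1)) * ρ (0, z) ^ γ
        = (1/γ) * ρ (0, z) ^ γ := by
      rw [e, hB]
      have : γ ≠ 0 := by linarith
      field_simp
      ring
    rw [this]
    ring
  rintro ⟨t, z⟩ hp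
  have hm : 0 ≤ t ∧ t < tCrit γ (𝓑 z) := by rw [hS] at hp; exact hp
  have hc : ContinuousAt (fun y => tCrit γ (𝓑 y)) z := by
    unfold tCrit
    exact (continuousAt_const.mul h𝓑.continuous.continuousAt).rpow_const
      (Or.inr (by positivity))
  have hev : ∀ᶠ y in nhds z, (t, y) ∈ S := by
    filter_upwards [hc.eventually (lt_mem_nhds hm.2)] with y hy
    rw [hS]
    exact ⟨hm.1, hy⟩
  have hline : HasDerivAt (fun y : ℝ => (t, y)) ((0:ℝ), (1:ℝ)) z :=
    (hasDerivAt_const z t).prodMk (hasDerivAt_id z)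
  have hrd : HasDerivAt (fun y => ρ (t, y)) (fderiv ℝ ρ (t, z) (0, 1)) z :=
    (hdiff _ hp).hasFDerivAt.comp_hasDerivAt z hline
  have hmain := aux_deriv γ hγ (fun y => ρ (t, y)) 𝓑 (fun _ => t) _ (deriv 𝓑 z) 0 z hrd
    ((h𝓑.differentiable one_ne_zero) z).hasDerivAt (hasDerivAt_const _ _) (hpos _ hp)
    (by
      filter_upwards [hev] with y hy
      exact hbern _ hy)
  have h2 := (hmain.sub_const ((1/γ) * ρ (0, Q) ^ γ)).congr_of_eventuallyEq
    (f₁ := fun y => (1/2) * (∫ τ in (0:ℝ)..t, 1 / ρ (τ, y)) +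
          (1/γ) * (ρ (0, y) ^ γ - ρ (0, Q) ^ γ))
    (by
      filter_upwards [hev] with y hy
      exact key t y hy)
  refine h2.congr_deriv ?_
  simp
end

section
/- Let D ⊆ ℝ² be open and bounded, let λ, Q ∈ ℝ, and let G : [0,∞) × ℝ → ℝ be C¹; set g(t,z) := 2∂ₜG(t,z). Let ψ : D → ℝ be Lipschitz and suppose J(ψ) ≤ J(φ) for every Lipschitz φ : D → ℝ such that {x : φ(x) ≠ ψ(x)} has compact closure contained in D, where J(φ) = ∫_D [G(|∇φ|², φ) + λ²·χ_{{φ<Q}}] dx. Then ψ is a weak supersolution of the Euler–Lagrange equation in all of D: for every smooth, nonnegative ζ with compact support in D, ∫_D [g(|∇ψ|², ψ) ∇ψ·∇ζ + ∂_zG(|∇ψ|², ψ) ζ] dx ≥ 0, where ∇ψ denotes the almost-everywhere defined gradient of ψ. -/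
open Set MeasureTheory RealInnerProductSpace

noncomputable abbrev E2 : Type := EuclideanSpace ℝ (Fin 2)

/-- Partial derivative of a Lagrangian `G(t,z)` with respect to `t` (within the natural
domain `[0,∞) × ℝ`). -/
noncomputable def Gt (G : ℝ → ℝ → ℝ) (t z : ℝ) : ℝ :=
  fderivWithin ℝ (fun p : ℝ × ℝ => G p.1 p.2) (Ici (0:ℝ) ×ˢ univ) (t, z) (1, 0)

/-- Partial derivative of a Lagrangian `G(t,z)` with respect to `z` (within the natural
domain `[0,∞) × ℝ`). -/
noncomputable def Gz (G : ℝ → ℝ → ℝ) (t z : ℝ) : ℝ :=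
  fderivWithin ℝ (fun p : ℝ × ℝ => G p.1 p.2) (Ici (0:ℝ) ×ˢ univ) (t, z) (0, 1)

open Filter Topology

lemma aux_ptbound {φ : E2 → ℝ} {D : Set E2} (hD : IsOpen D) {K : NNReal}
    (h : LipschitzOnWith K φ D) {x : E2} (hx : x ∈ D) : ‖gradient φ x‖ ≤ K := by
  have : ‖gradient φ x‖ = ‖fderiv ℝ φ x‖ := by simp [gradient]
  rw [this]
  exact norm_fderiv_le_of_lipschitzOn ℝ (hD.mem_nhds hx) h

lemma aux_meas_grad (φ : E2 → ℝ) : Measurable (gradient φ) := by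
  have h : Measurable (fderiv ℝ φ) := measurable_fderiv ℝ φ
  exact (InnerProductSpace.toDual ℝ E2).symm.continuous.measurable.comp h

lemma aux_bdd {φ : E2 → ℝ} {D : Set E2} (hDb : Bornology.IsBounded D) {K : NNReal}
    (h : LipschitzOnWith K φ D) : ∃ R : ℝ, 0 ≤ R ∧ ∀ x ∈ D, |φ x| ≤ R := by
  have hb : Bornology.IsBounded (φ '' D) := by
    obtain ⟨f, hf, hfe⟩ := h.extend_real
    rw [hfe.image_eq]
    exact hf.isBounded_image hDb
  obtain ⟨R, hR⟩ := hb.exists_norm_le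
  exact ⟨max R 0, le_max_right _ _, fun x hx =>
    (hR _ (mem_image_of_mem _ hx)).trans (le_max_left _ _)⟩

lemma aux_int (D : Set E2) (hD : IsOpen D) (hDbdd : Bornology.IsBounded D)
    (G : ℝ → ℝ → ℝ)
    (hG : ContinuousOn (fun p : ℝ × ℝ => G p.1 p.2) (Ici (0:ℝ) ×ˢ univ))
    (φ : E2 → ℝ) (K : NNReal) (h : LipschitzOnWith K φ D) :
    Integrable (fun x => G (‖gradient φ x‖ ^ 2) (φ x)) (volume.restrict D) := by
  obtain ⟨R, hR0, hR⟩ := aux_bdd hDbdd h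
  have hfin : IsFiniteMeasure (volume.restrict D) :=
    ⟨by simpa using hDbdd.measure_lt_top⟩
  have hcomp : IsCompact (Icc (0:ℝ) ((K:ℝ)^2) ×ˢ Icc (-R) R) := isCompact_Icc.prod isCompact_Icc
  have hsub : Icc (0:ℝ) ((K:ℝ)^2) ×ˢ Icc (-R) R ⊆ Ici (0:ℝ) ×ˢ univ := by
    rintro ⟨a, b⟩ ⟨h1, h2⟩
    exact ⟨h1.1, trivial⟩
  obtain ⟨C, hC⟩ := hcomp.exists_bound_of_continuousOn (hG.mono hsub)
  have hφ : AEMeasurable φ (volume.restrict D) := h.continuousOn.aemeasurable hD.measurableSet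
  have hH : Continuous (fun p : ℝ × ℝ => G (max p.1 0) p.2) := by
    have : Continuous (fun p : ℝ × ℝ => ((max p.1 0, p.2) : ℝ × ℝ)) := by fun_prop
    exact hG.comp_continuous this (fun p => ⟨mem_Ici.2 (le_max_right p.1 0), trivial⟩)
  refine Integrable.of_bound (C := C) ?_ ?_
  · have h1 : AEMeasurable (fun x => ((‖gradient φ x‖ ^ 2, φ x) : ℝ × ℝ)) (volume.restrict D) :=
      (((aux_meas_grad φ).norm.pow_const 2).aemeasurable).prodMk hφ
    have h2 := (hH.measurable.comp_aemeasurable h1).aestronglyMeasurable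
    refine h2.congr (Eventually.of_forall fun x => ?_)
    have : (0:ℝ) ≤ ‖gradient φ x‖ ^ 2 := by positivity
    simp [Function.comp, max_eq_left this]
  · filter_upwards [ae_restrict_mem hD.measurableSet] with x hx
    refine hC (‖gradient φ x‖ ^ 2, φ x) ⟨⟨by positivity, ?_⟩, abs_le.1 (hR x hx)⟩
    exact pow_le_pow_left₀ (norm_nonneg _) (aux_ptbound hD h hx) 2

lemma aux_int_ind (D : Set E2) (hD : IsOpen D) (hDbdd : Bornology.IsBounded D)
    (c Q : ℝ) (φ : E2 → ℝ) (K : NNReal) (h : LipschitzOnWith K φ D) :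
    Integrable (fun x => if φ x < Q then c else 0) (volume.restrict D) := by
  have hfin : IsFiniteMeasure (volume.restrict D) :=
    ⟨by simpa using hDbdd.measure_lt_top⟩
  have hφ : AEMeasurable φ (volume.restrict D) := h.continuousOn.aemeasurable hD.measurableSet
  have hm : Measurable (fun z : ℝ => if z < Q then c else 0) :=
    Measurable.ite measurableSet_Iio measurable_const measurable_const
  refine Integrable.of_bound (C := |c|) (hm.comp_aemeasurable hφ).aestronglyMeasurable ?_
  refine Eventually.of_forall fun x => ?_
  split_ifs <;> simp

lemma aux_deriv_s10 (G : ℝ → ℝ → ℝ)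
    (hG : ContDiffOn ℝ 1 (fun p : ℝ × ℝ => G p.1 p.2) (Ici (0:ℝ) ×ˢ univ))
    (a b : E2) (z w : ℝ) :
    HasDerivAt (fun e : ℝ => G (‖a + e • b‖ ^ 2) (z + e * w))
      ((2 * Gt G (‖a‖ ^ 2) z) * ⟪a, b⟫ + Gz G (‖a‖ ^ 2) z * w) 0 := by
  have hmem : ((‖a‖ ^ 2, z) : ℝ × ℝ) ∈ Ici (0:ℝ) ×ˢ (univ : Set ℝ) :=
    ⟨by simp, trivial⟩
  have h1 := ((hG.differentiableOn (by norm_num)) _ hmem).hasFDerivWithinAt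
  have h2 : HasDerivAt (fun e : ℝ => a + e • b) b 0 := by
    simpa using ((hasDerivAt_id (0:ℝ)).smul_const b).const_add a
  have h3 : HasDerivAt (fun e : ℝ => ‖a + e • b‖ ^ 2) (2 * ⟪a, b⟫) 0 := by
    simpa using h2.norm_sq
  have h4 : HasDerivAt (fun e : ℝ => z + e * w) w 0 := by
    simpa using ((hasDerivAt_id (0:ℝ)).mul_const w).const_add z
  have h5 := (h3.prodMk h4).hasDerivWithinAt (s := univ)
  have h6 := HasFDerivWithinAt.comp_hasDerivWithinAt_of_eq (x := (0:ℝ)) (s := univ) h1 h5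
    (fun e _ => ⟨by simp, trivial⟩) (by simp)
  rw [hasDerivWithinAt_univ] at h6
  refine h6.congr_deriv ?_
  have : ((2 * ⟪a, b⟫, w) : ℝ × ℝ) = (2 * ⟪a, b⟫) • ((1, 0) : ℝ × ℝ) + w • ((0, 1) : ℝ × ℝ) := by
    simp
  rw [this, map_add, map_smul, map_smul]
  simp only [Gt, Gz, smul_eq_mul]
  ring

lemma aux_lip_s10 (G : ℝ → ℝ → ℝ)
    (hG : ContDiffOn ℝ 1 (fun p : ℝ × ℝ => G p.1 p.2) (Ici (0:ℝ) ×ˢ univ)) (A R : ℝ) :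
    ∃ C : ℝ, 0 ≤ C ∧ ∀ p ∈ Icc (0:ℝ) A ×ˢ Icc (-R) R, ∀ q ∈ Icc (0:ℝ) A ×ˢ Icc (-R) R,
      |G q.1 q.2 - G p.1 p.2| ≤ C * (|q.1 - p.1| + |q.2 - p.2|) := by
  have hcomp : IsCompact (Icc (0:ℝ) A ×ˢ Icc (-R) R) := isCompact_Icc.prod isCompact_Icc
  have hconv : Convex ℝ (Icc (0:ℝ) A ×ˢ Icc (-R) R) := (convex_Icc _ _).prod (convex_Icc _ _)
  have hsub : Icc (0:ℝ) A ×ˢ Icc (-R) R ⊆ Ici (0:ℝ) ×ˢ univ := by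
    rintro ⟨a, b⟩ ⟨h1, h2⟩
    exact ⟨h1.1, trivial⟩
  have hud : UniqueDiffOn ℝ (Ici (0:ℝ) ×ˢ (univ : Set ℝ)) :=
    (uniqueDiffOn_Ici 0).prod uniqueDiffOn_univ
  have hc := hG.continuousOn_fderivWithin hud le_rfl
  obtain ⟨C, hC⟩ := hcomp.exists_bound_of_continuousOn (hc.mono hsub)
  refine ⟨max C 0, le_max_right _ _, fun p hp q hq => ?_⟩
  have := hconv.norm_image_sub_le_of_norm_hasFDerivWithin_le (C := max C 0)
    (fun x hx => (((hG.differentiableOn (by norm_num)) x (hsub hx)).hasFDerivWithinAt).mono hsub)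
    (fun x hx => (hC x hx).trans (le_max_left _ _)) hp hq
  refine this.trans (mul_le_mul_of_nonneg_left ?_ (le_max_right _ _))
  rw [Prod.norm_def]
  exact max_le (le_add_of_nonneg_right (abs_nonneg _)) (le_add_of_nonneg_left (abs_nonneg _))

/-- A Lipschitz minimizer `ψ` of `J(φ) = ∫_D G(|∇φ|², φ) + λ²χ_{{φ<Q}}` on a bounded
open set `D ⊆ ℝ²` (against compactly supported Lipschitz perturbations) is a weak
supersolution of the Euler–Lagrange equation in all of `D`: for every smooth
nonnegative `ζ` compactly supported in `D`,
`∫_D g(|∇ψ|²,ψ)∇ψ·∇ζ + ∂_zG(|∇ψ|²,ψ)ζ ≥ 0`, where `g = 2∂ₜG`. -/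
theorem minimizer_is_weak_supersolution
    (D : Set E2) (hD : IsOpen D) (hDbdd : Bornology.IsBounded D)
    (lam Q : ℝ)
    (G : ℝ → ℝ → ℝ)
    (hG : ContDiffOn ℝ 1 (fun p : ℝ × ℝ => G p.1 p.2) (Ici (0:ℝ) ×ˢ univ))
    (ψ : E2 → ℝ) (K : NNReal) (hψlip : LipschitzOnWith K ψ D)
    (hmin : ∀ (φ : E2 → ℝ) (K' : NNReal), LipschitzOnWith K' φ D →
      IsCompact (closure {x | φ x ≠ ψ x}) →
      closure {x | φ x ≠ ψ x} ⊆ D →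
      (∫ x in D, (G (‖gradient ψ x‖ ^ 2) (ψ x) + if ψ x < Q then lam ^ 2 else 0)) ≤
        ∫ x in D, (G (‖gradient φ x‖ ^ 2) (φ x) + if φ x < Q then lam ^ 2 else 0)) :
    ∀ ζ : E2 → ℝ, ContDiff ℝ (⊤ : ℕ∞) ζ → HasCompactSupport ζ → tsupport ζ ⊆ D →
      (∀ x, 0 ≤ ζ x) →
      0 ≤ ∫ x in D,
        ((2 * Gt G (‖gradient ψ x‖ ^ 2) (ψ x)) * ⟪gradient ψ x, gradient ζ x⟫ +
          Gz G (‖gradient ψ x‖ ^ 2) (ψ x) * ζ x) := by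
  intro ζ hζ hζc hζs hζ0
  have hfin : IsFiniteMeasure (volume.restrict D) :=
    ⟨by simpa using hDbdd.measure_lt_top⟩
  have hGc := hG.continuousOn
  have hζd : Differentiable ℝ ζ := hζ.differentiable (by simp)
  obtain ⟨L, hL⟩ : ∃ L, LipschitzWith L ζ :=
    (hζ.of_le (by simp : (1 : WithTop ℕ∞) ≤ ((⊤ : ℕ∞) : WithTop ℕ∞))).lipschitzWith_of_hasCompactSupport hζc (by simp)
  have hLD : LipschitzOnWith L ζ D := hL.lipschitzOnWith
  obtain ⟨M, hM0, hM⟩ := aux_bdd hDbdd hLD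
  obtain ⟨R, hR0, hR⟩ := aux_bdd hDbdd hψlip
  obtain ⟨C, hC0, hC⟩ := aux_lip_s10 G hG (((K:ℝ) + L) ^ 2) (R + M)
  have hφlip : ∀ e : ℝ, LipschitzOnWith (K + ‖e‖₊ * L) (fun x => ψ x + e * ζ x) D := by
    intro e
    refine hψlip.add ?_
    have := (lipschitzWith_smul (β := ℝ) e).comp_lipschitzOnWith hLD
    simpa [Function.comp_def] using this
  have hdiff : ∀ᵐ x ∂(volume.restrict D), x ∈ D ∧ DifferentiableAt ℝ ψ x := by
    have h1 := hψlip.ae_differentiableWithinAt (μ := volume) hD.measurableSet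
    filter_upwards [h1, ae_restrict_mem hD.measurableSet] with x hx hxD
    exact ⟨hxD, hx.differentiableAt (hD.mem_nhds hxD)⟩
  have hgrad : ∀ e : ℝ, ∀ x, DifferentiableAt ℝ ψ x →
      gradient (fun x => ψ x + e * ζ x) x = gradient ψ x + e • gradient ζ x := by
    intro e x hx
    have : fderiv ℝ (fun x => ψ x + e * ζ x) x = fderiv ℝ ψ x + e • fderiv ℝ ζ x :=
      (hx.hasFDerivAt.add ((hζd x).hasFDerivAt.const_mul e)).fderiv
    simp [gradient, this]
  have hI0 := aux_int D hD hDbdd G hGc ψ K hψlip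
  have hI := fun e : ℝ => aux_int D hD hDbdd G hGc _ _ (hφlip e)
  have hX0 := aux_int_ind D hD hDbdd (lam ^ 2) Q ψ K hψlip
  have hX := fun e : ℝ => aux_int_ind D hD hDbdd (lam ^ 2) Q _ _ (hφlip e)
  set q : ℝ → E2 → ℝ := fun e x =>
    e⁻¹ * (G (‖gradient (fun x => ψ x + e * ζ x) x‖ ^ 2) (ψ x + e * ζ x)
      - G (‖gradient ψ x‖ ^ 2) (ψ x)) with hq
  have hpos : ∀ e : ℝ, 0 < e → 0 ≤ ∫ x in D, q e x := by
    intro e he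
    have hsub : {x | ψ x + e * ζ x ≠ ψ x} ⊆ Function.support ζ := by
      intro x hx hx0
      exact hx (by simp [hx0])
    have hcl : closure {x | ψ x + e * ζ x ≠ ψ x} ⊆ tsupport ζ := closure_mono hsub
    have hm := hmin (fun x => ψ x + e * ζ x) _ (hφlip e)
      (hζc.of_isClosed_subset isClosed_closure hcl) (hcl.trans hζs)
    have h1 : (∫ x in D, (G (‖gradient (fun x => ψ x + e * ζ x) x‖ ^ 2) (ψ x + e * ζ x)
        + if ψ x + e * ζ x < Q then lam ^ 2 else 0)) =
        (∫ x in D, G (‖gradient (fun x => ψ x + e * ζ x) x‖ ^ 2) (ψ x + e * ζ x)) +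
        ∫ x in D, (if ψ x + e * ζ x < Q then lam ^ 2 else 0) := integral_add (hI e) (hX e)
    have h2 : (∫ x in D, (G (‖gradient ψ x‖ ^ 2) (ψ x) + if ψ x < Q then lam ^ 2 else 0)) =
        (∫ x in D, G (‖gradient ψ x‖ ^ 2) (ψ x)) +
        ∫ x in D, (if ψ x < Q then lam ^ 2 else 0) := integral_add hI0 hX0
    have h3 : (∫ x in D, (if ψ x + e * ζ x < Q then lam ^ 2 else 0)) ≤
        ∫ x in D, (if ψ x < Q then lam ^ 2 else 0) := by
      refine integral_mono (hX e) hX0 fun x => ?_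
      have : 0 ≤ e * ζ x := mul_nonneg he.le (hζ0 x)
      have hl : 0 ≤ lam ^ 2 := sq_nonneg _
      dsimp only
      split_ifs <;> first | linarith | exact le_rfl
    rw [hq]
    dsimp only
    rw [integral_const_mul, integral_sub (hI e) hI0]
    refine mul_nonneg (inv_nonneg.2 he.le) ?_
    linarith
  have hlim : Tendsto (fun e => ∫ x in D, q e x) (𝓝[>] (0:ℝ)) (𝓝 (∫ x in D,
        ((2 * Gt G (‖gradient ψ x‖ ^ 2) (ψ x)) * ⟪gradient ψ x, gradient ζ x⟫ +
          Gz G (‖gradient ψ x‖ ^ 2) (ψ x) * ζ x))) := by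
    refine tendsto_integral_filter_of_dominated_convergence
      (fun _ => C * ((2 * K + L) * L + M)) ?_ ?_ (integrable_const _) ?_
    · exact Eventually.of_forall fun e => (((hI e).sub hI0).const_mul _).aestronglyMeasurable
    · filter_upwards [Ioo_mem_nhdsGT (zero_lt_one' ℝ)] with e he
      filter_upwards [hdiff] with x hx
      have ha := aux_ptbound hD hψlip hx.1
      have hb := aux_ptbound hD hLD hx.1
      have hz := hR x hx.1
      have hw := hM x hx.1
      simp only [hq]
      rw [hgrad e x hx.2]
      generalize gradient ψ x = a at *
      generalize gradient ζ x = b at *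
      have he0 : 0 < e := he.1
      have hn1 : ‖a + e • b‖ ≤ ‖a‖ + e * L := by
        refine (norm_add_le _ _).trans ?_
        rw [norm_smul, Real.norm_of_nonneg he0.le]
        gcongr
      have hn2 : ‖a‖ - e * L ≤ ‖a + e • b‖ := by
        have h := norm_sub_le (a + e • b) (e • b)
        rw [add_sub_cancel_right, norm_smul, Real.norm_of_nonneg he0.le] at h
        have : e * ‖b‖ ≤ e * L := by gcongr
        linarith
      have hL0 : (0:ℝ) ≤ L := L.2
      have hK0 : (0:ℝ) ≤ K := K.2
      have heL : e * L ≤ L := by nlinarith [he.2]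
      have hn3 : ‖a + e • b‖ ≤ K + L := by linarith
      have hew : |e * ζ x| ≤ e * M := by
        rw [abs_mul, abs_of_pos he0]; gcongr
      have heM : e * M ≤ M := by nlinarith [he.2]
      have h1 := hC (‖a‖ ^ 2, ψ x)
        ⟨⟨by positivity, by simp only; gcongr; linarith⟩, abs_le.1 (by linarith)⟩
        (‖a + e • b‖ ^ 2, ψ x + e * ζ x)
        ⟨⟨by positivity, by simp only; gcongr⟩,
          abs_le.1 ((abs_add_le _ _).trans (by linarith))⟩
      simp only [add_sub_cancel_left] at h1
      have h2 : |‖a + e • b‖ ^ 2 - ‖a‖ ^ 2| ≤ e * ((2 * K + L) * L) := by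
        rw [sq_sub_sq, abs_mul]
        have e1 : |‖a + e • b‖ + ‖a‖| ≤ 2 * K + L := by
          rw [abs_of_nonneg (by positivity)]; linarith
        have e2 : |‖a + e • b‖ - ‖a‖| ≤ e * L := abs_le.2 ⟨by linarith, by linarith⟩
        calc _ ≤ (2 * K + L) * (e * L) := by gcongr
          _ = _ := by ring
      rw [norm_mul, Real.norm_of_nonneg (inv_nonneg.2 he0.le), inv_mul_le_iff₀ he0]
      refine h1.trans ?_
      calc C * (|‖a + e • b‖ ^ 2 - ‖a‖ ^ 2| + |e * ζ x|)
          ≤ C * (e * ((2 * K + L) * L) + e * M) := by gcongr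
        _ = _ := by ring
    · filter_upwards [hdiff] with x hx
      have h := (aux_deriv_s10 G hG (gradient ψ x) (gradient ζ x) (ψ x) (ζ x)).tendsto_slope_zero_right
      refine h.congr fun e => ?_
      simp only [hq]
      rw [hgrad e x hx.2]
      simp
  exact ge_of_tendsto hlim (by
    filter_upwards [self_mem_nhdsWithin] with e he
    exact hpos e he)
end

section
/- Let D ⊆ ℝ² be open and bounded, let λ ∈ ℝ, Q > 0 and 𝔟₊ > 0. Let 𝒢 : ℝ² × ℝ → ℝ be C¹ and satisfy: p·∇ₚ𝒢(p,z) ≥ 𝔟₊|p|² for all (p,z), and ∂_z𝒢(p,z) = 0 whenever z ≤ 0 or z ≥ Q. Let ψ : D̄ → ℝ be Lipschitz with 0 ≤ ψ(x) ≤ Q for every x in the boundary ∂D, and suppose ψ minimizes J(φ) = ∫_D [𝒢(∇φ, φ) + λ²·χ_{{φ<Q}}] dx among all Lipschitz φ : D̄ → ℝ with φ = ψ on ∂D. Then 0 ≤ ψ(x) ≤ Q for every x ∈ D. -/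
open Set MeasureTheory RealInnerProductSpace

open Filter Topology

lemma ae_line {p : E2 → Prop} (h : ∀ᵐ z, p z) (v : E2) :
    ∀ᵐ y : E2, ∀ᵐ t : ℝ, p (y + t • v) := by
  obtain ⟨N, hN, hNm, hN0⟩ : ∃ N : Set E2, {z | ¬ p z} ⊆ N ∧ MeasurableSet N ∧ volume N = 0 :=
    ⟨toMeasurable volume _, subset_toMeasurable _ _, measurableSet_toMeasurable _ _, by
      rw [measure_toMeasurable]; exact h⟩
  have hm : Measurable (fun q : E2 × ℝ => q.1 + q.2 • v) := by fun_prop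
  have key : ∀ᵐ y : E2, ∀ᵐ t : ℝ, y + t • v ∉ N := by
    rw [Measure.ae_ae_comm (hm hNm).compl]
    refine Eventually.of_forall fun t => ?_
    have : volume ((fun y : E2 => y + t • v) ⁻¹' N) = 0 := by
      rw [measure_preimage_add_right]; exact hN0
    rw [ae_iff]
    simp only [not_not]
    exact this
  filter_upwards [key] with y hy
  filter_upwards [hy] with t ht
  by_contra hc
  exact ht (hN hc)

lemma local_const {f : E2 → ℝ} {K : NNReal} (hf : LipschitzWith K f) {a : E2} {r : ℝ}
    (h : ∀ᵐ x, x ∈ Metric.ball a r → fderiv ℝ f x = 0) {x : E2} (hx : x ∈ Metric.ball a r) :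
    f x = f a := by
  have hr : 0 < r := lt_of_le_of_lt dist_nonneg (Metric.mem_ball.1 hx)
  set v : E2 := x - a with hv
  have hd : ∀ᵐ z, z ∈ Metric.ball a r → HasFDerivAt f (0 : E2 →L[ℝ] ℝ) z := by
    filter_upwards [h, hf.ae_differentiableAt (μ := volume)] with z h1 h2 hz
    rw [← h1 hz]; exact h2.hasFDerivAt
  have hl := ae_line hd v
  by_contra hne
  let U : Set E2 := (Metric.ball a r ∩ (fun y => y + v) ⁻¹' Metric.ball a r) ∩
    {y | f (y + v) ≠ f y}
  have hUo : IsOpen U := by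
    refine (Metric.isOpen_ball.inter (Metric.isOpen_ball.preimage (by fun_prop))).inter ?_
    exact isOpen_ne_fun (hf.continuous.comp (by fun_prop)) hf.continuous
  have haU : a ∈ U := by
    refine ⟨⟨Metric.mem_ball_self hr, ?_⟩, ?_⟩
    · simpa [hv, dist_eq_norm] using hx
    · simpa [hv] using hne
  have hpos : volume U ≠ 0 := (hUo.measure_pos volume ⟨a, haU⟩).ne'
  apply hpos
  refine measure_mono_null ?_ hl
  intro y hy hc
  obtain ⟨⟨hy1, hy2⟩, hy3⟩ := hy
  apply hy3
  let g : ℝ → ℝ := fun t => f (y + t • v)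
  have hgl : LipschitzWith (K * ‖v‖₊) g := by
    refine hf.comp ?_
    refine LipschitzWith.of_dist_le_mul fun s t => ?_
    rw [dist_add_left, dist_eq_norm, ← sub_smul, norm_smul, dist_eq_norm, mul_comm]
    rfl
  have hac : AbsolutelyContinuousOnInterval g 0 1 :=
    (hgl.lipschitzOnWith (s := uIcc 0 1)).absolutelyContinuousOnInterval
  have h1 := hac.integral_deriv_eq_sub
  have h2 : ∫ t in (0:ℝ)..1, deriv g t = ∫ t in (0:ℝ)..1, (0:ℝ) := by
    apply intervalIntegral.integral_congr_ae
    filter_upwards [hc] with t ht htI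
    rw [uIoc_of_le zero_le_one] at htI
    have hmem : y + t • v ∈ Metric.ball a r := by
      have := (convex_ball a r).add_smul_mem hy1 hy2 (t := t) ⟨htI.1.le, htI.2⟩
      exact this
    have hfd := ht hmem
    have : HasDerivAt g ((0 : E2 →L[ℝ] ℝ) v) t := by
      have hlin : HasDerivAt (fun t : ℝ => y + t • v) v t := by
        simpa using ((hasDerivAt_id t).smul_const v).const_add y
      exact hfd.comp_hasDerivAt t hlin
    simpa using this.deriv
  rw [h2] at h1
  simp [g] at h1
  linarith

lemma upper_bound {D : Set E2} (hD : IsOpen D) (hDb : Bornology.IsBounded D)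
    {f : E2 → ℝ} {K : NNReal} (hf : LipschitzWith K f) {c : ℝ}
    (hbd : ∀ x ∈ frontier D, f x ≤ c)
    (h : ∀ᵐ x, x ∈ D → c < f x → fderiv ℝ f x = 0) : ∀ x ∈ D, f x ≤ c := by
  intro x hx
  by_contra hlt
  push Not at hlt
  have hcomp : IsCompact (closure D) := hDb.isCompact_closure
  obtain ⟨m, hm, hmax⟩ := hcomp.exists_isMaxOn ⟨x, subset_closure hx⟩ hf.continuous.continuousOn
  have hxm : f x ≤ f m := hmax (subset_closure hx)
  let A : Set E2 := closure D ∩ {y | f y = f m}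
  have hAc : IsClosed A := isClosed_closure.inter (isClosed_eq hf.continuous continuous_const)
  have hAo : IsOpen A := by
    rw [Metric.isOpen_iff]
    rintro y ⟨hy1, hy2⟩
    have hy2 : f y = f m := hy2
    have hyD : y ∈ D := by
      by_contra hn
      have : y ∈ frontier D := ⟨hy1, by rwa [hD.interior_eq]⟩
      have := hbd y this
      linarith
    have hopen : IsOpen (D ∩ {z | c < f z}) :=
      hD.inter (isOpen_lt continuous_const hf.continuous)
    obtain ⟨r, hr, hsub⟩ := Metric.isOpen_iff.1 hopen y ⟨hyD, by
      show c < f y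
      linarith⟩
    refine ⟨r, hr, fun z hz => ⟨subset_closure (hsub hz).1, ?_⟩⟩
    have : f z = f y := local_const hf (a := y) (r := r) (by
      filter_upwards [h] with w hw hwb
      exact hw (hsub hwb).1 (hsub hwb).2) hz
    exact this.trans hy2
  have hAu : A = univ := IsClopen.eq_univ ⟨hAc, hAo⟩ ⟨m, hm, rfl⟩
  have hbA : Bornology.IsBounded A := hcomp.isBounded.subset inter_subset_left
  rw [hAu] at hbA
  exact NormedSpace.unbounded_univ ℝ E2 hbA

lemma G_strict {bstar : ℝ} (hb : 0 < bstar) {𝒢 : E2 → ℝ → ℝ}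
    (h𝒢 : ContDiff ℝ 1 (fun q : E2 × ℝ => 𝒢 q.1 q.2))
    (hconv : ∀ (p : E2) (z : ℝ),
      bstar * ‖p‖ ^ 2 ≤ ⟪p, gradient (fun q => 𝒢 q z) p⟫) (p : E2) (hp : p ≠ 0) (z : ℝ) :
    𝒢 0 z < 𝒢 p z := by
  have hd : Differentiable ℝ (fun q => 𝒢 q z) := by
    have h1 : Differentiable ℝ (fun q : E2 => (q, z)) := by fun_prop
    exact (h𝒢.differentiable one_ne_zero).comp h1
  have hder : ∀ t : ℝ, HasDerivAt (fun t : ℝ => 𝒢 (t • p) z)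
      ⟪gradient (fun q => 𝒢 q z) (t • p), p⟫ t := by
    intro t
    have h1 : HasDerivAt (fun t : ℝ => t • p) p t := by
      simpa using (hasDerivAt_id t).smul_const p
    have h2 := (hd (t • p)).hasGradientAt.hasFDerivAt.comp_hasDerivAt t h1
    exact h2
  have hmono : StrictMonoOn (fun t : ℝ => 𝒢 (t • p) z) (Icc 0 1) := by
    apply strictMonoOn_of_deriv_pos (convex_Icc 0 1)
    · exact fun t _ => (hder t).continuousAt.continuousWithinAt
    · intro t ht
      rw [interior_Icc] at ht
      rw [(hder t).deriv]
      have h1 := hconv (t • p) z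
      rw [real_inner_smul_left, real_inner_comm] at h1
      have h2 : 0 < bstar * ‖t • p‖ ^ 2 := by
        have : 0 < ‖t • p‖ := norm_pos_iff.2 (smul_ne_zero ht.1.ne' hp)
        positivity
      exact pos_of_mul_pos_right (lt_of_lt_of_le h2 h1) ht.1.le
  have := hmono (left_mem_Icc.2 zero_le_one) (right_mem_Icc.2 zero_le_one) zero_lt_one
  simpa using this

lemma const_z {g : ℝ → ℝ} (hg : Differentiable ℝ g) {a b : ℝ} (hab : a ≤ b)
    (h : ∀ z ∈ Ioo a b, deriv g z = 0) : g a = g b := by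
  rcases hab.eq_or_lt with rfl | hlt
  · rfl
  obtain ⟨c, hc, hc'⟩ := exists_deriv_eq_slope g hlt hg.continuous.continuousOn
    hg.differentiableOn
  rw [h c hc] at hc'
  have : b - a ≠ 0 := by linarith
  field_simp at hc'
  linarith

lemma integrable_J {D : Set E2} (hD : IsOpen D) (hDb : Bornology.IsBounded D) (lam Q : ℝ)
    {𝒢 : E2 → ℝ → ℝ} (h𝒢 : Continuous (fun q : E2 × ℝ => 𝒢 q.1 q.2))
    {f : E2 → ℝ} {K : NNReal} (hf : LipschitzWith K f) :
    IntegrableOn (fun x => 𝒢 (gradient f x) (f x) + if f x < Q then lam ^ 2 else 0) D := by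
  have hgm : Measurable (gradient f) :=
    (InnerProductSpace.toDual ℝ E2).symm.continuous.measurable.comp (measurable_fderiv ℝ f)
  have hgb : ∀ x, gradient f x ∈ Metric.closedBall (0 : E2) K := by
    intro x
    rw [mem_closedBall_zero_iff]
    unfold gradient
    rw [LinearIsometryEquiv.norm_map]
    exact norm_fderiv_le_of_lipschitz ℝ hf
  have hcomp : IsCompact (closure D) := hDb.isCompact_closure
  have hfc : IsCompact (f '' closure D) := hcomp.image hf.continuous
  obtain ⟨C, hC⟩ := ((isCompact_closedBall (0 : E2) K).prod hfc).exists_bound_of_continuousOn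
    h𝒢.continuousOn
  have hfin : volume D < ⊤ := hDb.measure_lt_top
  refine IntegrableOn.add ?_ ?_
  · refine Measure.integrableOn_of_bounded (M := C) hfin.ne ?_ ?_
    · exact (h𝒢.measurable.comp (hgm.prodMk hf.continuous.measurable)).aestronglyMeasurable
    · filter_upwards [ae_restrict_mem hD.measurableSet] with x hx
      exact hC (gradient f x, f x) ⟨hgb x, mem_image_of_mem f (subset_closure hx)⟩
  · refine Measure.integrableOn_of_bounded (M := lam ^ 2) hfin.ne ?_ ?_
    · exact (Measurable.ite (measurableSet_lt hf.continuous.measurable measurable_const)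
        measurable_const measurable_const).aestronglyMeasurable
    · refine Eventually.of_forall fun x => ?_
      split_ifs <;> simp [sq_nonneg]

/-- Maximum principle for minimizers: if `𝒢(p,z)` is `C¹` with `p·∇ₚ𝒢(p,z) ≥ 𝔟₊|p|²`
and `∂_z𝒢(p,z) = 0` for `z ≤ 0` or `z ≥ Q`, and a Lipschitz function `ψ` with boundary
values in `[0,Q]` minimizes `J(φ) = ∫_D 𝒢(∇φ,φ) + λ²χ_{{φ<Q}}` among Lipschitz
functions with the same boundary values on the bounded open set `D`, then
`0 ≤ ψ ≤ Q` in `D`. -/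
theorem minimizer_bounds
    (D : Set E2) (hD : IsOpen D) (hDbdd : Bornology.IsBounded D)
    (lam Q bstar : ℝ) (hQ : 0 < Q) (hb : 0 < bstar)
    (𝒢 : E2 → ℝ → ℝ)
    (h𝒢 : ContDiff ℝ 1 (fun q : E2 × ℝ => 𝒢 q.1 q.2))
    (hconv : ∀ (p : E2) (z : ℝ),
      bstar * ‖p‖ ^ 2 ≤ ⟪p, gradient (fun q => 𝒢 q z) p⟫)
    (hz : ∀ (p : E2) (z : ℝ), z ≤ 0 ∨ Q ≤ z → deriv (𝒢 p) z = 0)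
    (ψ : E2 → ℝ) (K : NNReal) (hψlip : LipschitzOnWith K ψ (closure D))
    (hbdry : ∀ x ∈ frontier D, ψ x ∈ Icc 0 Q)
    (hmin : ∀ (φ : E2 → ℝ) (K' : NNReal), LipschitzOnWith K' φ (closure D) →
      (∀ x ∈ frontier D, φ x = ψ x) →
      (∫ x in D, (𝒢 (gradient ψ x) (ψ x) + if ψ x < Q then lam ^ 2 else 0)) ≤
        ∫ x in D, (𝒢 (gradient φ x) (φ x) + if φ x < Q then lam ^ 2 else 0)) :
    ∀ x ∈ D, ψ x ∈ Icc 0 Q := by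
  obtain ⟨f, hf, hfψ⟩ := hψlip.extend_real
  have hgrad : ∀ x ∈ D, gradient ψ x = gradient f x := by
    intro x hx
    have : ψ =ᶠ[𝓝 x] f := by
      filter_upwards [hD.mem_nhds hx] with y hy using hfψ (subset_closure hy)
    unfold gradient
    rw [this.fderiv_eq]
  have hbf : ∀ x ∈ frontier D, f x ∈ Icc 0 Q := fun x hx => by
    rw [← hfψ (frontier_subset_closure hx)]; exact hbdry x hx
  let φ : E2 → ℝ := fun x => max 0 (min Q (f x))
  have hφ : LipschitzWith K φ := (hf.const_min Q).const_max 0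
  have hle := hmin φ K hφ.lipschitzOnWith (fun x hx => by
    have := hbf x hx
    rw [hfψ (frontier_subset_closure hx)]
    simp only [φ]
    rw [min_eq_right this.2, max_eq_right this.1])
  have heq : (∫ x in D, (𝒢 (gradient ψ x) (ψ x) + if ψ x < Q then lam ^ 2 else 0)) =
      ∫ x in D, (𝒢 (gradient f x) (f x) + if f x < Q then lam ^ 2 else 0) := by
    apply setIntegral_congr_fun hD.measurableSet
    intro x hx
    simp only [hgrad x hx, hfψ (subset_closure hx)]
  rw [heq] at hle
  have hzd : ∀ p, Differentiable ℝ (𝒢 p) := by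
    intro p
    have h1 : Differentiable ℝ (fun z : ℝ => (p, z)) := by fun_prop
    exact (h𝒢.differentiable one_ne_zero).comp h1
  have hif := integrable_J hD hDbdd lam Q h𝒢.continuous hf
  have hiφ := integrable_J hD hDbdd lam Q h𝒢.continuous hφ
  -- pointwise comparison
  have hin : ∀ x, 0 < f x → f x < Q → 𝒢 (gradient φ x) (φ x) = 𝒢 (gradient f x) (f x) ∧
      φ x = f x := by
    intro x h0 h1
    have : φ =ᶠ[𝓝 x] f := by
      filter_upwards [hf.continuous.continuousAt.eventually (lt_mem_nhds h0),
        hf.continuous.continuousAt.eventually (gt_mem_nhds h1)] with y hy1 hy2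
      simp only [φ]
      rw [min_eq_right hy2.le, max_eq_right hy1.le]
    unfold gradient
    rw [this.fderiv_eq, this.eq_of_nhds]
    exact ⟨rfl, rfl⟩
  have hlow : ∀ x, f x ≤ 0 → gradient φ x = 0 ∧ φ x = 0 := by
    intro x h0
    have hx : φ x = 0 := by
      simp only [φ]
      exact max_eq_left ((min_le_right _ _).trans h0)
    refine ⟨?_, hx⟩
    have : IsLocalMin φ x := Eventually.of_forall fun y => by
      rw [hx]; exact le_max_left _ _
    unfold gradient
    rw [this.fderiv_eq_zero, map_zero]
  have hhigh : ∀ x, Q ≤ f x → gradient φ x = 0 ∧ φ x = Q := by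
    intro x h0
    have hx : φ x = Q := by
      simp only [φ]
      rw [min_eq_left h0, max_eq_right hQ.le]
    refine ⟨?_, hx⟩
    have : IsLocalMax φ x := Eventually.of_forall fun y => by
      rw [hx]; exact max_le hQ.le (min_le_left _ _)
    unfold gradient
    rw [this.fderiv_eq_zero, map_zero]
  have hzl : ∀ z ≤ 0, 𝒢 0 z = 𝒢 0 0 := fun z hz0 =>
    const_z (hzd 0) hz0 fun w hw => hz 0 w (Or.inl hw.2.le)
  have hzh : ∀ z, Q ≤ z → 𝒢 0 z = 𝒢 0 Q := fun z hz0 =>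
    (const_z (hzd 0) hz0 fun w hw => hz 0 w (Or.inr hw.1.le)).symm
  have hG0 : ∀ p z, 𝒢 0 z ≤ 𝒢 p z := by
    intro p z
    by_cases hp : p = 0
    · rw [hp]
    · exact (G_strict hb h𝒢 hconv p hp z).le
  let F : E2 → ℝ := fun x => (𝒢 (gradient f x) (f x) + if f x < Q then lam ^ 2 else 0) -
    (𝒢 (gradient φ x) (φ x) + if φ x < Q then lam ^ 2 else 0)
  have hFout : ∀ x, (f x ≤ 0 ∨ Q ≤ f x) → F x = 𝒢 (gradient f x) (f x) - 𝒢 0 (f x) := by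
    rintro x (h | h)
    · obtain ⟨h1, h2⟩ := hlow x h
      simp only [F, h1, h2, hzl _ h, if_pos hQ, if_pos (lt_of_le_of_lt h hQ)]
      ring
    · obtain ⟨h1, h2⟩ := hhigh x h
      simp only [F, h1, h2, hzh _ h, lt_irrefl, if_neg (not_lt.2 h), if_false]
      ring
  have hF0 : ∀ x, 0 ≤ F x := by
    intro x
    by_cases h : f x ≤ 0 ∨ Q ≤ f x
    · rw [hFout x h]; linarith [hG0 (gradient f x) (f x)]
    · push Not at h
      obtain ⟨h1, h2⟩ := hin x h.1 h.2
      simp only [F]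
      rw [h1, h2]
      simp
  have hFint : IntegrableOn F D := hif.sub hiφ
  have hFI : ∫ x in D, F x = 0 := by
    apply le_antisymm
    · simp only [F]
      rw [integral_sub hif hiφ]
      linarith
    · exact integral_nonneg hF0
  have hFae : ∀ᵐ x, x ∈ D → F x = 0 := by
    have := (setIntegral_eq_zero_iff_of_nonneg_ae (Eventually.of_forall hF0) hFint).1 hFI
    exact (ae_restrict_iff' hD.measurableSet).1 this
  have hfd : ∀ᵐ x, x ∈ D → (f x ≤ 0 ∨ Q ≤ f x) → fderiv ℝ f x = 0 := by
    filter_upwards [hFae] with x hx hxD hout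
    have h0 := hx hxD
    rw [hFout x hout] at h0
    by_contra hne
    have : gradient f x ≠ 0 := by
      unfold gradient
      simpa using hne
    linarith [G_strict hb h𝒢 hconv _ this (f x)]
  intro x hx
  rw [hfψ (subset_closure hx)]
  constructor
  · have := upper_bound hD hDbdd (f := fun y => - f y) (K := K) (c := 0) hf.neg
      (fun y hy => by have := (hbf y hy).1; linarith) (by
        filter_upwards [hfd] with y hy hyD hlt
        have := hy hyD (Or.inl (by linarith))
        rw [fderiv_fun_neg, this, neg_zero]) x hx
    linarith
  · exact upper_bound hD hDbdd hf (fun y hy => (hbf y hy).2) (by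
        filter_upwards [hfd] with y hy hyD hlt
        exact hy hyD (Or.inr hlt.le)) x hx
end

section
/- Fix 𝔟₊ > 0 and H̄ > 0. There exists δ₀ > 0 depending only on 𝔟₊ and H̄ with the following property. Let δ ∈ (0, δ₀], let D ⊆ ℝ × (0, H̄) be bounded and open, and let 𝒢 : ℝ² × ℝ → ℝ be C² with ξ·D²ₚₚ𝒢(p,z)ξ ≥ 𝔟₊|ξ|² for all p, z, ξ, and with |∂²_{z pᵢ}𝒢(p,z)| ≤ δ (i = 1,2) and |∂²_{zz}𝒢(p,z)| ≤ δ for all (p,z). Let ψ, φ : D̄ → ℝ be Lipschitz and such that (i) for every smooth nonnegative ζ compactly supported in D, ∫_D [∇ₚ𝒢(∇ψ, ψ)·∇ζ + ∂_z𝒢(∇ψ, ψ) ζ] dx ≥ 0 (ψ is a weak supersolution); (ii) for every smooth ζ compactly supported in D, ∫_D [∇ₚ𝒢(∇φ, φ)·∇ζ + ∂_z𝒢(∇φ, φ) ζ] dx = 0 (φ is a weak solution); and (iii) φ(x) ≤ ψ(x) for every x ∈ ∂D. Then φ ≤ ψ everywhere in D. -/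
open Set MeasureTheory RealInnerProductSpace

section partA
variable {𝒢 : E2 → ℝ → ℝ}

lemma cp_fderiv_eq (hG : ContDiff ℝ 2 (fun q : E2 × ℝ => 𝒢 q.1 q.2)) (p : E2) (z : ℝ) :
    HasFDerivAt (fun q => 𝒢 q z)
      ((fderiv ℝ (fun q : E2 × ℝ => 𝒢 q.1 q.2) (p, z)).comp (ContinuousLinearMap.inl ℝ E2 ℝ)) p := by
  have h := (hG.differentiable (by norm_num) (p, z)).hasFDerivAt
  exact HasFDerivAt.comp (g := fun q : E2 × ℝ => 𝒢 q.1 q.2) p h (hasFDerivAt_prodMk_left (𝕜 := ℝ) p z)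

lemma cp_deriv_eq (hG : ContDiff ℝ 2 (fun q : E2 × ℝ => 𝒢 q.1 q.2)) (p : E2) (z : ℝ) :
    HasDerivAt (𝒢 p) (fderiv ℝ (fun q : E2 × ℝ => 𝒢 q.1 q.2) (p, z) (0, 1)) z := by
  have h := (hG.differentiable (by norm_num) (p, z)).hasFDerivAt
  have hl : HasDerivAt (fun w : ℝ => (p, w)) ((0 : E2), (1 : ℝ)) z :=
    (hasDerivAt_const z p).prodMk (hasDerivAt_id z)
  exact HasFDerivAt.comp_hasDerivAt (l := fun q : E2 × ℝ => 𝒢 q.1 q.2) z h hl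

lemma cp_contA (hG : ContDiff ℝ 2 (fun q : E2 × ℝ => 𝒢 q.1 q.2)) :
    ContDiff ℝ 1 (fun q : E2 × ℝ => gradient (fun p => 𝒢 p q.2) q.1) := by
  have : (fun q : E2 × ℝ => gradient (fun p => 𝒢 p q.2) q.1) = fun q =>
      (InnerProductSpace.toDual ℝ E2).symm
        ((fderiv ℝ (fun q : E2 × ℝ => 𝒢 q.1 q.2) q).comp (ContinuousLinearMap.inl ℝ E2 ℝ)) := by
    ext1 q
    rw [gradient, (cp_fderiv_eq hG q.1 q.2).fderiv]
  rw [this]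
  have h1 : ContDiff ℝ 1 (fderiv ℝ (fun q : E2 × ℝ => 𝒢 q.1 q.2)) :=
    hG.fderiv_right (by norm_num)
  exact (InnerProductSpace.toDual ℝ E2).symm.contDiff.comp (h1.clm_comp contDiff_const)

lemma cp_contB (hG : ContDiff ℝ 2 (fun q : E2 × ℝ => 𝒢 q.1 q.2)) :
    ContDiff ℝ 1 (fun q : E2 × ℝ => deriv (𝒢 q.1) q.2) := by
  have : (fun q : E2 × ℝ => deriv (𝒢 q.1) q.2) = fun q =>
      fderiv ℝ (fun q : E2 × ℝ => 𝒢 q.1 q.2) q (0, 1) := by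
    ext1 q
    rw [(cp_deriv_eq hG q.1 q.2).deriv]
  rw [this]
  have h1 : ContDiff ℝ 1 (fderiv ℝ (fun q : E2 × ℝ => 𝒢 q.1 q.2)) :=
    hG.fderiv_right (by norm_num)
  exact h1.clm_apply contDiff_const

/-- z-Lipschitz bound for A -/
lemma cp_Az (hG : ContDiff ℝ 2 (fun q : E2 × ℝ => 𝒢 q.1 q.2)) {δ : ℝ}
    (h : ∀ (p : E2) (z : ℝ) (i : Fin 2),
          |deriv (fun w => gradient (fun q => 𝒢 q w) p i) z| ≤ δ) (p ξ : E2) (z z' : ℝ) :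
    |⟪gradient (fun q => 𝒢 q z) p - gradient (fun q => 𝒢 q z') p, ξ⟫| ≤ 2 * δ * |z - z'| * ‖ξ‖ := by
  have hA := cp_contA hG
  have hd : Differentiable ℝ (fun w => gradient (fun q => 𝒢 q w) p) :=
    (hA.comp (contDiff_const (c := p) |>.prodMk contDiff_id)).differentiable (by norm_num)
  have hi : ∀ i : Fin 2, |gradient (fun q => 𝒢 q z) p i - gradient (fun q => 𝒢 q z') p i|
      ≤ δ * |z - z'| := by
    intro i
    have hdi : Differentiable ℝ (fun w => gradient (fun q => 𝒢 q w) p i) :=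
      (differentiable_euclidean.1 hd) i
    have := Convex.norm_image_sub_le_of_norm_deriv_le (𝕜 := ℝ) (s := univ)
      (f := fun w => gradient (fun q => 𝒢 q w) p i) (C := δ) (x := z') (y := z)
      (fun x _ => hdi x) (fun x _ => h p x i) convex_univ trivial trivial
    simpa using this
  have hx : ∀ i : Fin 2, |ξ i| ≤ ‖ξ‖ := fun i => by simpa using PiLp.norm_apply_le ξ i
  have hδ : 0 ≤ δ * |z - z'| := (abs_nonneg _).trans (hi 0)
  rw [PiLp.inner_apply, Fin.sum_univ_two]
  simp only [PiLp.sub_apply, RCLike.inner_apply, conj_trivial]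
  refine (abs_add_le _ _).trans ?_
  rw [abs_mul, abs_mul]
  have h0 := mul_le_mul (hx 0) (hi 0) (abs_nonneg _) (norm_nonneg _)
  have h1 := mul_le_mul (hx 1) (hi 1) (abs_nonneg _) (norm_nonneg _)
  linarith

lemma cp_Ap (hG : ContDiff ℝ 2 (fun q : E2 × ℝ => 𝒢 q.1 q.2)) {b : ℝ}
    (h : ∀ (p ξ : E2) (z : ℝ),
          b * ‖ξ‖ ^ 2 ≤ ⟪ξ, fderiv ℝ (fun q => gradient (fun w => 𝒢 w z) q) p ξ⟫)
    (p p' : E2) (z : ℝ) :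
    b * ‖p - p'‖ ^ 2 ≤ ⟪gradient (fun q => 𝒢 q z) p - gradient (fun q => 𝒢 q z) p', p - p'⟫ := by
  have hA := cp_contA hG
  have hd : Differentiable ℝ (fun q => gradient (fun w => 𝒢 w z) q) :=
    (hA.comp (contDiff_id.prodMk (contDiff_const (c := z)))).differentiable (by norm_num)
  set ξ := p - p' with hξ
  have hk : ∀ t : ℝ, HasDerivAt (fun t : ℝ => ⟪ξ, gradient (fun w => 𝒢 w z) (p' + t • ξ)⟫)
      ⟪ξ, fderiv ℝ (fun q => gradient (fun w => 𝒢 w z) q) (p' + t • ξ) ξ⟫ t := by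
    intro t
    have hl : HasDerivAt (fun t : ℝ => p' + t • ξ) ξ t := by
      simpa using ((hasDerivAt_id t).smul_const ξ).const_add p'
    have h1 := (hd (p' + t • ξ)).hasFDerivAt.comp_hasDerivAt t hl
    simpa using (hasDerivAt_const t ξ).inner ℝ h1
  have := mul_sub_le_image_sub_of_le_deriv (fun t => (hk t).differentiableAt)
    (C := b * ‖ξ‖ ^ 2) (fun t => by rw [(hk t).deriv]; exact h _ _ _) (zero_le_one)
  rw [real_inner_comm, inner_sub_right]
  simpa [hξ] using this

lemma cp_B (hG : ContDiff ℝ 2 (fun q : E2 × ℝ => 𝒢 q.1 q.2)) {δ : ℝ} (hδ : 0 < δ)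
    (h : ∀ (p : E2) (z : ℝ) (i : Fin 2),
          |deriv (fun w => gradient (fun q => 𝒢 q w) p i) z| ≤ δ)
    (h' : ∀ (p : E2) (z : ℝ), |deriv (deriv (𝒢 p)) z| ≤ δ) (p p' : E2) (z z' : ℝ) :
    |deriv (𝒢 p) z - deriv (𝒢 p') z'| ≤ 2 * δ * ‖p - p'‖ + δ * |z - z'| := by
  have e1 : |deriv (𝒢 p) z - deriv (𝒢 p') z| ≤ 2 * δ * ‖p - p'‖ := by
    rw [← deriv_fun_sub (cp_deriv_eq hG p z).differentiableAt (cp_deriv_eq hG p' z).differentiableAt]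
    refine norm_deriv_le_of_lip' (𝕜 := ℝ) (F := ℝ) (by positivity) (Filter.Eventually.of_forall fun y => ?_)
    set ξ := p - p' with hξ
    have hl : ∀ t : ℝ, HasDerivAt (fun t : ℝ => p' + t • ξ) ξ t := fun t => by
      simpa using ((hasDerivAt_id t).smul_const ξ).const_add p'
    have hG' : ∀ (z : ℝ) (q : E2), DifferentiableAt ℝ (fun q => 𝒢 q z) q :=
      fun z q => (cp_fderiv_eq hG q z).differentiableAt
    have hk : ∀ t : ℝ, HasDerivAt (fun t : ℝ => 𝒢 (p' + t • ξ) y - 𝒢 (p' + t • ξ) z)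
        ⟪gradient (fun q => 𝒢 q y) (p' + t • ξ) - gradient (fun q => 𝒢 q z) (p' + t • ξ), ξ⟫ t := by
      intro t
      have h1 := ((hG' y (p' + t • ξ)).hasFDerivAt.comp_hasDerivAt t (hl t)).sub
        ((hG' z (p' + t • ξ)).hasFDerivAt.comp_hasDerivAt t (hl t))
      rw [inner_sub_left]
      simp only [gradient, InnerProductSpace.toDual_symm_apply]
      exact h1
    have := Convex.norm_image_sub_le_of_norm_deriv_le (𝕜 := ℝ) (s := univ)
      (f := fun t : ℝ => 𝒢 (p' + t • ξ) y - 𝒢 (p' + t • ξ) z) (C := 2 * δ * |y - z| * ‖ξ‖)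
      (x := 0) (y := 1)
      (fun x _ => (hk x).differentiableAt) (fun x _ => by
        rw [(hk x).deriv]; exact cp_Az hG h _ _ _ _) convex_univ trivial trivial
    simp only [hξ, one_smul, add_sub_cancel, zero_smul, add_zero, sub_zero, norm_one, mul_one] at this
    rw [← hξ] at this
    calc _ = ‖𝒢 p y - 𝒢 p z - (𝒢 p' y - 𝒢 p' z)‖ := by congr 1; ring
      _ ≤ _ := this
      _ = _ := by rw [Real.norm_eq_abs]; ring
  have e2 : |deriv (𝒢 p') z - deriv (𝒢 p') z'| ≤ δ * |z - z'| := by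
    have hB : Differentiable ℝ (deriv (𝒢 p')) :=
      ((cp_contB hG).comp (contDiff_const (c := p') |>.prodMk contDiff_id)).differentiable
        (by norm_num)
    exact Convex.norm_image_sub_le_of_norm_deriv_le (𝕜 := ℝ) (s := univ)
      (fun x _ => hB x) (fun x _ => h' p' x) convex_univ trivial trivial
  have := abs_sub_le (deriv (𝒢 p) z) (deriv (𝒢 p') z) (deriv (𝒢 p') z')
  linarith

/-- pointwise inequality -/
lemma cp_pointwise (hG : ContDiff ℝ 2 (fun q : E2 × ℝ => 𝒢 q.1 q.2)) {δ b : ℝ} (hδ : 0 < δ)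
    (h0 : ∀ (p ξ : E2) (z : ℝ),
          b * ‖ξ‖ ^ 2 ≤ ⟪ξ, fderiv ℝ (fun q => gradient (fun w => 𝒢 w z) q) p ξ⟫)
    (h : ∀ (p : E2) (z : ℝ) (i : Fin 2),
          |deriv (fun w => gradient (fun q => 𝒢 q w) p i) z| ≤ δ)
    (h' : ∀ (p : E2) (z : ℝ), |deriv (deriv (𝒢 p)) z| ≤ δ)
    (p p' : E2) (z z' v ε L M : ℝ) (hε : 0 ≤ ε) (hv : 0 ≤ v) (hz : z - z' = v + ε)
    (hL : ‖p - p'‖ ≤ L) (hM : v ≤ M) :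
    (⟪gradient (fun q => 𝒢 q z') p', p - p'⟫ + deriv (𝒢 p') z' * v)
      - (⟪gradient (fun q => 𝒢 q z) p, p - p'⟫ + deriv (𝒢 p) z * v)
    ≤ -(b - 2 * δ) * ‖p - p'‖ ^ 2 + 3 * δ * v ^ 2 + ε * (δ * (2 * L + M)) := by
  have a1 := cp_Ap hG h0 p p' z
  have a2 := (abs_le.1 (cp_Az hG h p' (p - p') z z')).1
  have a3 := (abs_le.1 (cp_B hG hδ h h' p p' z z')).1
  rw [hz, abs_of_nonneg (by positivity)] at a2 a3
  rw [inner_sub_left] at a1 a2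
  have a4 := mul_le_mul_of_nonneg_right a3 hv
  set g := ‖p - p'‖
  have hg : 0 ≤ g := norm_nonneg _
  have b1 : 0 ≤ ε * δ * (L - g) := mul_nonneg (by positivity) (by linarith)
  have b2 : 0 ≤ ε * δ * (M - v) := mul_nonneg (by positivity) (by linarith)
  have b3 : 0 ≤ δ * (v - g) ^ 2 := by positivity
  nlinarith
end partA

section partB
open Filter Topology ContinuousLinearMap
open scoped Convolution

lemma cp_mollify {v : E2 → ℝ} {L : NNReal} (hv : LipschitzWith L v) (hc : HasCompactSupport v)
    (hv0 : ∀ x, 0 ≤ v x) {D : Set E2} (hD : IsOpen D) (hs : tsupport v ⊆ D) :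
    ∃ ζ : ℕ → E2 → ℝ, (∀ n, ContDiff ℝ (⊤ : ℕ∞) (ζ n)) ∧ (∀ n, HasCompactSupport (ζ n)) ∧
      (∀ n, tsupport (ζ n) ⊆ D) ∧ (∀ n x, 0 ≤ ζ n x) ∧
      (∀ n x, ‖fderiv ℝ (ζ n) x‖ ≤ L) ∧ (∀ n x, |ζ n x - v x| ≤ L) ∧
      (∀ x, Tendsto (fun n => ζ n x) atTop (𝓝 (v x))) ∧
      (∀ᵐ x, Tendsto (fun n => fderiv ℝ (ζ n) x) atTop (𝓝 (fderiv ℝ v x))) := by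
  obtain ⟨r, hr, hrD⟩ := IsCompact.exists_cthickening_subset_open hc hD hs
  set r' := min r 1 with hr'
  have hr'0 : 0 < r' := lt_min hr one_pos
  let φ : ℕ → ContDiffBump (0 : E2) := fun n =>
    ⟨r' / (n + 1) / 2, r' / (n + 1), by positivity, by
      have : 0 < r' / (n + 1) := by positivity
      linarith⟩
  have hout : ∀ n, (φ n).rOut = r' / (n + 1) := fun n => rfl
  have hin : ∀ n, (φ n).rIn = r' / (n + 1) / 2 := fun n => rfl
  have hle : ∀ n, (φ n).rOut ≤ r' := fun n => by
    rw [hout]; exact div_le_self hr'0.le (by linarith [n.cast_nonneg (α := ℝ)])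
  have hlim : Tendsto (fun n => (φ n).rOut) atTop (𝓝 0) := by
    simp only [hout]
    have := (tendsto_one_div_add_atTop_nhds_zero_nat (𝕜 := ℝ)).const_mul r'
    simpa [div_eq_mul_inv] using this
  let ζ : ℕ → E2 → ℝ := fun n => (φ n).normed volume ⋆[lsmul ℝ ℝ, volume] v
  have hζ : ∀ n x, ζ n x = ∫ t, (φ n).normed volume t • v (x - t) := fun n x => rfl
  have hvc := hv.continuous
  have hdist : ∀ n x, |ζ n x - v x| ≤ L * (φ n).rOut := by
    intro n x
    have := (φ n).dist_normed_convolution_le (μ := volume) (g := v) (x₀ := x)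
      (ε := L * (φ n).rOut)
      hvc.aestronglyMeasurable (fun y hy => (hv.dist_le_mul y x).trans
        (mul_le_mul_of_nonneg_left (Metric.mem_ball.1 hy).le L.2))
    simpa [Real.dist_eq] using this
  have hsupp : ∀ n, tsupport (ζ n) ⊆ Metric.cthickening r (tsupport v) := by
    intro n
    refine closure_minimal ?_ Metric.isClosed_cthickening
    intro x hx
    by_contra hxn
    apply hx
    have hz : ∀ y ∈ Metric.ball x r, v y = 0 := by
      intro y hy
      by_contra hvy
      apply hxn
      refine Metric.mem_cthickening_of_dist_le x y r _ (subset_tsupport v hvy) ?_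
      rw [dist_comm]; exact (Metric.mem_ball.1 hy).le
    have hx0 := hz x (Metric.mem_ball_self hr)
    have := (φ n).normed_convolution_eq_right (μ := volume) (g := v) (x₀ := x) (fun y hy => by
      rw [hx0]
      exact hz y (Metric.ball_subset_ball ((hle n).trans (min_le_left _ _)) hy))
    exact this.trans hx0
  have hfd : ∀ n x, HasFDerivAt (ζ n) (∫ t, (φ n).normed volume t • fderiv ℝ v (x - t)) x := by
    intro n x
    have hcn : Continuous ((φ n).normed volume) := (φ n).contDiff_normed (n := 0) |>.continuous
    refine (hasFDerivAt_integral_of_dominated_loc_of_lip (μ := volume) (s := univ)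
      (F := fun x t => (φ n).normed volume t • v (x - t))
      (F' := fun t => (φ n).normed volume t • fderiv ℝ v (x - t))
      (bound := fun t => (φ n).normed volume t * L) univ_mem ?_ ?_ ?_ ?_ ?_ ?_).2
    · exact Eventually.of_forall fun y => (hcn.smul (hvc.comp (by fun_prop))).aestronglyMeasurable
    · refine Continuous.integrable_of_hasCompactSupport (hcn.smul (hvc.comp (by fun_prop))) ?_
      exact (φ n).hasCompactSupport_normed.smul_right
    · refine hcn.aestronglyMeasurable.smul ?_
      exact ((measurable_fderiv ℝ v).comp (measurable_const.sub measurable_id)).aestronglyMeasurable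
    · refine Eventually.of_forall fun t => LipschitzOnWith.of_dist_le_mul fun y _ z _ => ?_
      have hn := (φ n).nonneg_normed (μ := volume) t
      rw [Real.coe_nnabs, abs_of_nonneg (by positivity), dist_smul₀, Real.norm_of_nonneg hn,
        mul_assoc]
      refine mul_le_mul_of_nonneg_left ((hv.dist_le_mul _ _).trans ?_) hn
      simp
    · exact (φ n).integrable_normed.mul_const _
    · have := (Measure.measurePreserving_sub_left (volume : Measure E2) x).quasiMeasurePreserving.ae
        hv.ae_differentiableAt
      filter_upwards [this] with t ht
      have h1 : HasFDerivAt (fun y : E2 => v (y - t)) (fderiv ℝ v (x - t)) x := by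
        rw [hasFDerivAt_comp_sub]
        exact ht.hasFDerivAt
      exact h1.const_smul ((φ n).normed volume t)
  refine ⟨ζ, ?_, ?_, ?_, ?_, ?_, ?_, ?_, ?_⟩
  · intro n
    exact (φ n).hasCompactSupport_normed.contDiff_convolution_left _ (φ n).contDiff_normed
      hvc.locallyIntegrable
  · intro n
    exact (IsCompact.cthickening hc).of_isClosed_subset (isClosed_tsupport _) (hsupp n)
  · exact fun n => (hsupp n).trans hrD
  · intro n x
    rw [hζ]
    exact integral_nonneg fun t => smul_nonneg ((φ n).nonneg_normed t) (hv0 _)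
  · intro n x
    rw [(hfd n x).fderiv]
    have := norm_integral_le_of_norm_le (μ := volume)
      (f := fun t => (φ n).normed volume t • fderiv ℝ v (x - t))
      (g := fun t => (φ n).normed volume t * L) ((φ n).integrable_normed.mul_const _)
      (Eventually.of_forall fun t => by
        rw [norm_smul, Real.norm_of_nonneg ((φ n).nonneg_normed t)]
        exact mul_le_mul_of_nonneg_left (norm_fderiv_le_of_lipschitz ℝ hv) ((φ n).nonneg_normed t))
    rwa [integral_mul_const, (φ n).integral_normed, one_mul] at this
  · intro n x
    refine (hdist n x).trans (mul_le_of_le_one_right L.2 ((hle n).trans (min_le_right _ _)))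
  · intro x
    rw [tendsto_iff_dist_tendsto_zero]
    refine squeeze_zero (fun _ => dist_nonneg) (fun n => hdist n x) ?_
    simpa using hlim.const_mul (L : ℝ)
  · have hli : LocallyIntegrable (fderiv ℝ v) (volume : Measure E2) := by
      refine (locallyIntegrable_const (L : ℝ)).mono (measurable_fderiv ℝ v).aestronglyMeasurable
        (Eventually.of_forall fun x => ?_)
      simpa using norm_fderiv_le_of_lipschitz ℝ hv
    have := ContDiffBump.ae_convolution_tendsto_right_of_locallyIntegrable (μ := volume)
      (φ := φ) (K := 2) hlim (Eventually.of_forall fun n => by rw [hout, hin]; linarith) hli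
    filter_upwards [this] with x hx
    refine hx.congr fun n => ?_
    rw [(hfd n x).fderiv]
    rfl

lemma cp_poincare {v : E2 → ℝ} {L : NNReal} (hv : LipschitzWith L v) (hc : HasCompactSupport v)
    {H : ℝ} (hstrip : ∀ x, v x ≠ 0 → 0 < x 1 ∧ x 1 < H) :
    ∫ x, v x ^ 2 ≤ 4 * H ^ 2 * ∫ x, ‖fderiv ℝ v x‖ ^ 2 := by
  have hvc := hv.continuous
  obtain ⟨M, hM⟩ := hc.exists_bound_of_continuous hvc
  have hM0 : 0 ≤ M := (norm_nonneg _).trans (hM 0)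
  have hc2 : HasCompactSupport (fun x => v x ^ 2) :=
    hc.comp_left (g := fun t : ℝ => t ^ 2) (by norm_num)
  have hg : LipschitzWith (Real.toNNReal (2 * M * L)) (fun x => v x ^ 2) := by
    refine LipschitzWith.of_dist_le_mul fun x y => ?_
    rw [Real.coe_toNNReal _ (by positivity), Real.dist_eq, sq_sub_sq, abs_mul]
    have h1 : |v x + v y| ≤ 2 * M := by
      refine (abs_add_le _ _).trans ?_
      have := hM x; have := hM y; simp only [Real.norm_eq_abs] at *; linarith
    have h2 := hv.dist_le_mul x y
    rw [Real.dist_eq] at h2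
    rw [mul_assoc]
    exact mul_le_mul h1 h2 (abs_nonneg _) (by positivity)
  set e : E2 := EuclideanSpace.single 1 1 with he
  have hen : ‖e‖ = 1 := by simp [he]
  have hf : LipschitzWith 1 (fun x : E2 => x 1) := by
    refine LipschitzWith.of_dist_le_mul fun x y => ?_
    rw [Real.dist_eq, dist_eq_norm]
    simpa using PiLp.norm_apply_le (x - y) 1
  have key := hf.integral_lineDeriv_mul_eq (μ := volume) hg hc2 e
  have hfl : ∀ x : E2, lineDeriv ℝ (fun x : E2 => x 1) x e = 1 := by
    intro x
    have h1 : HasFDerivAt (fun x : E2 => x 1) (EuclideanSpace.proj (1 : Fin 2) : E2 →L[ℝ] ℝ) x :=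
      (EuclideanSpace.proj (1 : Fin 2) : E2 →L[ℝ] ℝ).hasFDerivAt
    rw [(h1.hasLineDerivAt e).lineDeriv]
    simp [he]
  simp only [hfl, one_mul] at key
  have hint2 : Integrable (fun x => v x ^ 2) := hg.continuous.integrable_of_hasCompactSupport hc2
  have hfint : Integrable (fun x => ‖fderiv ℝ v x‖ ^ 2) := by
    have h0 : IntegrableOn (fun x => ‖fderiv ℝ v x‖ ^ 2) (tsupport v) := by
      refine Measure.integrableOn_of_bounded (M := (L : ℝ) ^ 2) hc.measure_lt_top.ne
        ((measurable_fderiv ℝ v).norm.pow_const 2).aestronglyMeasurable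
        (Eventually.of_forall fun x => ?_)
      rw [Real.norm_of_nonneg (by positivity)]
      exact pow_le_pow_left₀ (norm_nonneg _) (norm_fderiv_le_of_lipschitz ℝ hv) 2
    refine (integrableOn_iff_integrable_of_support_subset ?_).1 h0
    intro x hx
    apply support_fderiv_subset ℝ
    intro h; apply hx; simp [h]
  have hle : ∫ x, lineDeriv ℝ (fun x => v x ^ 2) x (-e) * x 1 ≤
      ∫ x, (1 / 2 * v x ^ 2 + 2 * H ^ 2 * ‖fderiv ℝ v x‖ ^ 2) := by
    by_cases hi : Integrable (fun x : E2 => lineDeriv ℝ (fun x => v x ^ 2) x (-e) * x 1)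
    swap
    · rw [integral_undef hi]
      exact integral_nonneg fun x => by positivity
    refine integral_mono_ae hi ((hint2.const_mul _).add (hfint.const_mul _)) ?_
    filter_upwards [hv.ae_differentiableAt] with x hx
    have h1 := ((hx.hasFDerivAt.pow 2).hasLineDerivAt (-e)).lineDeriv
    rw [h1]
    have h2 : |fderiv ℝ v x e| ≤ ‖fderiv ℝ v x‖ := by
      simpa [hen] using (fderiv ℝ v x).le_opNorm e
    simp only [_root_.smul_apply, map_neg, smul_eq_mul]
    norm_num
    by_cases h0 : v x = 0
    · rw [h0]; simp; positivity
    · obtain ⟨ha, hb⟩ := hstrip x h0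
      have h3 : (x 1 * fderiv ℝ v x e) ^ 2 ≤ H ^ 2 * ‖fderiv ℝ v x‖ ^ 2 := by
        rw [mul_pow]
        refine mul_le_mul (pow_le_pow_left₀ ha.le hb.le 2) ?_ (sq_nonneg _) (sq_nonneg _)
        rw [← sq_abs]
        exact pow_le_pow_left₀ (abs_nonneg _) h2 2
      nlinarith [sq_nonneg (v x + 2 * (x 1 * fderiv ℝ v x e))]
  rw [integral_add (hint2.const_mul _) (hfint.const_mul _), integral_const_mul,
    integral_const_mul] at hle
  linarith

end partB

section partC
open Filter Topology

lemma cp_field {X : Type*} [NormedAddCommGroup X] {D : Set E2} (hD : IsOpen D)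
    (hDb : Bornology.IsBounded D) {φ : E2 → ℝ} {K : NNReal}
    (hφ : LipschitzOnWith K φ (closure D)) {Ω : E2 × ℝ → X} (hΩ : Continuous Ω) :
    (∃ C, ∀ x ∈ D, ‖Ω (gradient φ x, φ x)‖ ≤ C) ∧
      AEStronglyMeasurable (fun x => Ω (gradient φ x, φ x)) (volume.restrict D) := by
  constructor
  · obtain ⟨M, hM⟩ := (hDb.isCompact_closure.exists_bound_of_continuousOn hφ.continuousOn)
    obtain ⟨C, hC⟩ := ((isCompact_closedBall (0 : E2) K).prod
      (isCompact_closedBall (0 : ℝ) M)).exists_bound_of_continuousOn hΩ.continuousOn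
    refine ⟨C, fun x hx => hC _ ⟨?_, ?_⟩⟩
    · rw [mem_closedBall_zero_iff, gradient, LinearIsometryEquiv.norm_map]
      exact norm_fderiv_le_of_lipschitzOn ℝ (mem_of_superset (hD.mem_nhds hx) subset_closure) hφ
    · rw [mem_closedBall_zero_iff]
      exact hM x (subset_closure hx)
  · refine hΩ.comp_aestronglyMeasurable (AEStronglyMeasurable.prodMk ?_ ?_)
    · exact ((InnerProductSpace.toDual ℝ E2).symm.continuous.measurable.comp
        (measurable_fderiv ℝ φ)).aestronglyMeasurable
    · exact (hφ.continuousOn.mono subset_closure).aestronglyMeasurable hD.measurableSet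

lemma cp_grad_inner (F : E2) (ζ : E2 → ℝ) (x : E2) : ⟪F, gradient ζ x⟫ = fderiv ℝ ζ x F := by
  rw [real_inner_comm, gradient, InnerProductSpace.toDual_symm_apply]

lemma cp_limit {D : Set E2} (hD : IsOpen D) (hDb : Bornology.IsBounded D)
    {F : E2 → E2} {B : E2 → ℝ}
    (hF : ∃ C, ∀ x ∈ D, ‖F x‖ ≤ C) (hB : ∃ C, ∀ x ∈ D, ‖B x‖ ≤ C)
    (hFm : AEStronglyMeasurable F (volume.restrict D))
    (hBm : AEStronglyMeasurable B (volume.restrict D))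
    {v : E2 → ℝ} {L : NNReal} (hv : LipschitzWith L v) {M : ℝ} (hM : ∀ x, |v x| ≤ M)
    {ζ : ℕ → E2 → ℝ} (h1 : ∀ n, ContDiff ℝ (⊤ : ℕ∞) (ζ n))
    (h2 : ∀ n x, ‖fderiv ℝ (ζ n) x‖ ≤ L) (h3 : ∀ n x, |ζ n x - v x| ≤ L)
    (h4 : ∀ x, Tendsto (fun n => ζ n x) atTop (𝓝 (v x)))
    (h5 : ∀ᵐ x, Tendsto (fun n => fderiv ℝ (ζ n) x) atTop (𝓝 (fderiv ℝ v x))) :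
    Integrable (fun x => ⟪F x, gradient v x⟫ + B x * v x) (volume.restrict D) ∧
    Tendsto (fun n => ∫ x in D, (⟪F x, gradient (ζ n) x⟫ + B x * ζ n x)) atTop
      (𝓝 (∫ x in D, (⟪F x, gradient v x⟫ + B x * v x))) := by
  obtain ⟨CF, hCF⟩ := hF
  obtain ⟨CB, hCB⟩ := hB
  have hfin : volume D < ⊤ := hDb.measure_lt_top
  have : IsFiniteMeasure (volume.restrict D) := ⟨by simpa using hfin⟩
  have hgm : ∀ f : E2 → ℝ, Measurable (gradient f) := fun f =>
    (InnerProductSpace.toDual ℝ E2).symm.continuous.measurable.comp (measurable_fderiv ℝ f)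
  have hgn : ∀ (f : E2 → ℝ) x, ‖gradient f x‖ = ‖fderiv ℝ f x‖ := fun f x => by
    rw [gradient, LinearIsometryEquiv.norm_map]
  have hbd : ∀ f : E2 → ℝ, (∀ x, ‖fderiv ℝ f x‖ ≤ L) → (∀ x, |f x| ≤ M + L) → ∀ x ∈ D,
      ‖⟪F x, gradient f x⟫ + B x * f x‖ ≤ CF * L + CB * (M + L) := by
    intro f hf1 hf2 x hx
    refine (norm_add_le _ _).trans (add_le_add ?_ ?_)
    · refine (norm_inner_le_norm _ _).trans ?_
      rw [hgn]
      exact mul_le_mul (hCF x hx) (hf1 x) (norm_nonneg _) ((norm_nonneg _).trans (hCF x hx))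
    · rw [norm_mul]
      exact mul_le_mul (hCB x hx) (hf2 x) (norm_nonneg _) ((norm_nonneg _).trans (hCB x hx))
  have hmeas : ∀ f : E2 → ℝ, Continuous f → AEStronglyMeasurable
      (fun x => ⟪F x, gradient f x⟫ + B x * f x) (volume.restrict D) := fun f hf =>
    (hFm.inner (hgm f).aestronglyMeasurable).add (hBm.mul hf.aestronglyMeasurable)
  constructor
  · refine Integrable.of_bound (hmeas v hv.continuous) (CF * L + CB * (M + L)) ?_
    filter_upwards [ae_restrict_mem hD.measurableSet] with x hx
    exact hbd v (fun y => norm_fderiv_le_of_lipschitz ℝ hv)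
      (fun y => (hM y).trans (by linarith [L.coe_nonneg])) x hx
  · refine tendsto_integral_of_dominated_convergence (fun _ => CF * L + CB * (M + L))
      (fun n => hmeas _ (h1 n).continuous) (integrable_const _) ?_ ?_
    · intro n
      filter_upwards [ae_restrict_mem hD.measurableSet] with x hx
      refine hbd _ (h2 n) (fun y => ?_) x hx
      have := abs_sub_abs_le_abs_sub (ζ n y) (v y)
      linarith [h3 n y, hM y]
    · filter_upwards [ae_restrict_of_ae h5] with x hx
      simp only [cp_grad_inner]
      exact ((ContinuousLinearMap.apply ℝ ℝ (F x)).continuous.tendsto _ |>.comp hx).add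
        ((h4 x).const_mul _)

lemma cp_trunc {D : Set E2} (hD : IsOpen D) {w : E2 → ℝ} {L : NNReal}
    (hw : LipschitzOnWith L w (closure D)) (hb : ∀ x ∈ frontier D, w x ≤ 0) :
    LipschitzWith L (D.indicator fun x => max (w x) 0) := by
  set u := D.indicator fun x => max (w x) 0 with hu
  have hu0 : ∀ x, 0 ≤ u x := fun x => indicator_nonneg (fun _ _ => le_max_right _ _) x
  refine LipschitzWith.of_le_add_mul L fun x y => ?_
  by_cases hx : x ∈ D
  swap
  · have : u x = 0 := indicator_of_notMem hx _
    rw [this]; have := hu0 y; positivity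
  have hux : u x = max (w x) 0 := indicator_of_mem hx _
  rw [hux]
  refine max_le ?_ (by have := hu0 y; positivity)
  by_cases hy : y ∈ D
  · have huy : u y = max (w y) 0 := indicator_of_mem hy _
    have h1 := hw.dist_le_mul x (subset_closure hx) y (subset_closure hy)
    rw [Real.dist_eq] at h1
    rw [huy]
    linarith [le_abs_self (w x - w y), le_max_left (w y) 0]
  · have hz : ∃ z ∈ segment ℝ x y, z ∈ frontier D := by
      by_contra hcon
      push Not at hcon
      have hpre : IsPreconnected (segment ℝ x y) := (convex_segment x y).isPreconnected
      have := hpre D (closure D)ᶜ hD isClosed_closure.isOpen_compl (fun z hz => by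
          by_cases hzD : z ∈ D
          · exact Or.inl hzD
          · refine Or.inr fun hzc => hcon z hz ?_
            rw [hD.frontier_eq]; exact ⟨hzc, hzD⟩)
        ⟨x, left_mem_segment ℝ x y, hx⟩ ⟨y, right_mem_segment ℝ x y, fun hyc =>
          hcon y (right_mem_segment ℝ x y) (by rw [hD.frontier_eq]; exact ⟨hyc, hy⟩)⟩
      obtain ⟨z, -, hz1, hz2⟩ := this
      exact hz2 (subset_closure hz1)
    obtain ⟨z, hzs, hzf⟩ := hz
    have h1 := hw.dist_le_mul x (subset_closure hx) z (frontier_subset_closure hzf)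
    rw [Real.dist_eq] at h1
    have h2 := dist_add_dist_of_mem_segment hzs
    have h3 : dist x z ≤ dist x y := by linarith [dist_nonneg (x := z) (y := y)]
    have h4 := mul_le_mul_of_nonneg_left h3 L.2
    have h5 := hb z hzf
    have := hu0 y
    simp only [NNReal.val_eq_coe] at h4
    linarith [le_abs_self (w x - w z)]

end partC

open Filter Topology in
/-- Comparison principle for the quasilinear operator
`∇·(∇ₚ𝒢(∇ψ,ψ)) − ∂_z𝒢(∇ψ,ψ)`: for `𝔟₊ > 0` and `H̄ > 0` there is `δ₀ > 0` such that
whenever `𝒢` is `C²` with uniformly convex `p`-Hessian (`ξ·D²ₚₚ𝒢ξ ≥ 𝔟₊|ξ|²`) and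
`|∂²_{zpᵢ}𝒢| ≤ δ`, `|∂²_{zz}𝒢| ≤ δ` for some `δ ∈ (0, δ₀]`, a Lipschitz weak
supersolution `ψ` and a Lipschitz weak solution `φ` on a bounded open set
`D ⊆ ℝ × (0, H̄)` with `φ ≤ ψ` on `∂D` satisfy `φ ≤ ψ` in `D`. -/
theorem comparison_principle
    (bstar H : ℝ) (hb : 0 < bstar) (hH : 0 < H) :
    ∃ δ₀ : ℝ, 0 < δ₀ ∧
      ∀ δ : ℝ, 0 < δ → δ ≤ δ₀ →
      ∀ D : Set E2, IsOpen D → Bornology.IsBounded D →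
        (∀ x ∈ D, 0 < x 1 ∧ x 1 < H) →
      ∀ 𝒢 : E2 → ℝ → ℝ, ContDiff ℝ 2 (fun q : E2 × ℝ => 𝒢 q.1 q.2) →
        (∀ (p ξ : E2) (z : ℝ),
          bstar * ‖ξ‖ ^ 2 ≤ ⟪ξ, fderiv ℝ (fun q => gradient (fun w => 𝒢 w z) q) p ξ⟫) →
        (∀ (p : E2) (z : ℝ) (i : Fin 2),
          |deriv (fun w => gradient (fun q => 𝒢 q w) p i) z| ≤ δ) →
        (∀ (p : E2) (z : ℝ), |deriv (deriv (𝒢 p)) z| ≤ δ) →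
      ∀ ψ φ : E2 → ℝ,
        (∃ K : NNReal, LipschitzOnWith K ψ (closure D)) →
        (∃ K : NNReal, LipschitzOnWith K φ (closure D)) →
        (∀ ζ : E2 → ℝ, ContDiff ℝ (⊤ : ℕ∞) ζ → HasCompactSupport ζ → tsupport ζ ⊆ D →
          (∀ x, 0 ≤ ζ x) →
          0 ≤ ∫ x in D,
            (⟪gradient (fun q => 𝒢 q (ψ x)) (gradient ψ x), gradient ζ x⟫ +
              deriv (𝒢 (gradient ψ x)) (ψ x) * ζ x)) →
        (∀ ζ : E2 → ℝ, ContDiff ℝ (⊤ : ℕ∞) ζ → HasCompactSupport ζ → tsupport ζ ⊆ D →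
          (∫ x in D,
            (⟪gradient (fun q => 𝒢 q (φ x)) (gradient φ x), gradient ζ x⟫ +
              deriv (𝒢 (gradient φ x)) (φ x) * ζ x)) = 0) →
        (∀ x ∈ frontier D, φ x ≤ ψ x) →
        ∀ x ∈ D, φ x ≤ ψ x := by
  have hden : 0 < 4 + 24 * H ^ 2 := by positivity
  refine ⟨bstar / (4 + 24 * H ^ 2), by positivity, ?_⟩
  intro δ hδ hδ0 D hD hDb hDs 𝒢 hG hG1 hG2 hG3 ψ φ ⟨K1, hψ⟩ ⟨K2, hφ⟩ hsup hsol hbd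
  rw [le_div_iff₀ hden] at hδ0
  set w : E2 → ℝ := fun x => φ x - ψ x with hw
  set L : NNReal := K2 + K1 with hL
  have hwL : LipschitzOnWith L w (closure D) := hφ.sub hψ
  set u : E2 → ℝ := D.indicator fun x => max (w x) 0 with hu
  have huL : LipschitzWith L u := cp_trunc hD hwL (fun x hx => sub_nonpos.2 (hbd x hx))
  have hu0 : ∀ x, 0 ≤ u x := fun x => indicator_nonneg (fun _ _ => le_max_right _ _) x
  have huD : ∀ x, x ∉ D → u x = 0 := fun x hx => indicator_of_notMem hx _
  have huD' : ∀ x, x ∈ D → u x = max (w x) 0 := fun x hx => indicator_of_mem hx _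
  have huc : HasCompactSupport u := HasCompactSupport.intro hDb.isCompact_closure
    (fun x hx => huD x fun h => hx (subset_closure h))
  obtain ⟨M, hM⟩ := huc.exists_bound_of_continuous huL.continuous
  have hM0 : 0 ≤ M := (norm_nonneg _).trans (hM 0)
  have hfin : volume D < ⊤ := hDb.measure_lt_top
  have hfinI : IsFiniteMeasure (volume.restrict D) := ⟨by simpa using hfin⟩
  have hgn : ∀ (f : E2 → ℝ) x, ‖gradient f x‖ = ‖fderiv ℝ f x‖ := fun f x => by
    rw [gradient, LinearIsometryEquiv.norm_map]
  have hcA := (cp_contA hG).continuous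
  have hcB := (cp_contB hG).continuous
  set c := δ * (2 * L + M) with hc
  have hc0 : 0 ≤ c := by positivity
  have hdψ : ∀ᵐ x ∂(volume.restrict D), DifferentiableAt ℝ ψ x := by
    filter_upwards [ae_restrict_mem hD.measurableSet,
      ae_restrict_of_ae (hψ.mono subset_closure).ae_differentiableWithinAt_of_mem] with x hx h
    exact (h hx).differentiableAt (hD.mem_nhds hx)
  have hdφ : ∀ᵐ x ∂(volume.restrict D), DifferentiableAt ℝ φ x := by
    filter_upwards [ae_restrict_mem hD.measurableSet,
      ae_restrict_of_ae (hφ.mono subset_closure).ae_differentiableWithinAt_of_mem] with x hx h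
    exact (h hx).differentiableAt (hD.mem_nhds hx)
  have main : ∃ C : ℝ, ∀ ε : ℝ, 0 < ε → ∫ x, (max (u x - ε) 0) ^ 2 ≤ C * ε := by
    refine ⟨4 * H ^ 2 * (2 / bstar * (c * volume.real D)), fun ε hε => ?_⟩
    set v : E2 → ℝ := fun x => max (u x - ε) 0 with hv
    have hvL : LipschitzWith L v := by
      refine LipschitzWith.of_le_add_mul L fun x y => ?_
      have h1 := huL.le_add_mul x y
      refine max_le ?_ ?_
      · linarith [le_max_left (u y - ε) 0]
      · have : 0 ≤ v y := le_max_right _ _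
        positivity
    have hv0 : ∀ x, 0 ≤ v x := fun x => le_max_right _ _
    have hvM : ∀ x, v x ≤ M := fun x => max_le (by
      have := (le_abs_self _).trans (hM x); linarith) hM0
    have hts : tsupport v ⊆ {x | ε ≤ u x} := by
      refine closure_minimal ?_ (isClosed_le continuous_const huL.continuous)
      intro x hx
      by_contra hlt
      exact hx (max_eq_right (by simp only [mem_ofPred_eq, not_le] at hlt; linarith))
    have hvs : tsupport v ⊆ D := by
      intro x hx
      by_contra hxD
      have := hts hx
      simp only [mem_ofPred_eq, huD x hxD] at this
      linarith
    have hvc : HasCompactSupport v := huc.mono' (by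
      intro x hx
      have h1 : ε ≤ u x := hts (subset_tsupport v hx)
      exact subset_tsupport u (by simp only [Function.mem_support]; linarith))
    obtain ⟨ζ, z1, z2, z3, z4, z5, z6, z7, z8⟩ := cp_mollify hvL hvc hv0 hD hvs
    obtain ⟨i1, t1⟩ := cp_limit hD hDb (cp_field hD hDb hψ hcA).1 (cp_field hD hDb hψ hcB).1
      (cp_field hD hDb hψ hcA).2 (cp_field hD hDb hψ hcB).2 hvL (M := M)
      (fun x => by rw [abs_of_nonneg (hv0 x)]; exact hvM x) z1 z5 z6 z7 z8
    obtain ⟨i2, t2⟩ := cp_limit hD hDb (cp_field hD hDb hφ hcA).1 (cp_field hD hDb hφ hcB).1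
      (cp_field hD hDb hφ hcA).2 (cp_field hD hDb hφ hcB).2 hvL (M := M)
      (fun x => by rw [abs_of_nonneg (hv0 x)]; exact hvM x) z1 z5 z6 z7 z8
    have I1 := ge_of_tendsto' t1 (fun n => hsup (ζ n) (z1 n) (z2 n) (z3 n) (z4 n))
    have I2 := tendsto_nhds_unique (t2.congr (fun n => hsol (ζ n) (z1 n) (z2 n) (z3 n)))
      tendsto_const_nhds
    have hfb : ∀ x, ‖fderiv ℝ v x‖ ≤ L := fun x => norm_fderiv_le_of_lipschitz ℝ hvL
    have j1 : Integrable (fun x => ‖fderiv ℝ v x‖ ^ 2) (volume.restrict D) := by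
      refine Integrable.of_bound ((measurable_fderiv ℝ v).norm.pow_const 2).aestronglyMeasurable
        ((L : ℝ) ^ 2) (Eventually.of_forall fun x => ?_)
      rw [Real.norm_of_nonneg (by positivity)]
      exact pow_le_pow_left₀ (norm_nonneg _) (hfb x) 2
    have j2 : Integrable (fun x => v x ^ 2) (volume.restrict D) := by
      refine Integrable.of_bound (hvL.continuous.pow 2).aestronglyMeasurable
        (M ^ 2) (Eventually.of_forall fun x => ?_)
      rw [Real.norm_of_nonneg (by positivity)]
      exact pow_le_pow_left₀ (hv0 x) (hvM x) 2
    have I3 := integral_mono_ae (i1.sub i2)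
      (((j1.const_mul (-(bstar - 2 * δ))).add (j2.const_mul (3 * δ))).add
        (integrable_const (ε * c))) (by
      filter_upwards [ae_restrict_mem hD.measurableSet, hdψ, hdφ] with x hx dψ dφ
      simp only [Pi.sub_apply, Pi.add_apply]
      by_cases hux : ε < u x
      · have hev : v =ᶠ[𝓝 x] fun y => (φ y - ψ y) - ε := by
          filter_upwards [hD.mem_nhds hx,
            (isOpen_lt continuous_const huL.continuous).mem_nhds hux] with y hy hy2
          rw [huD' y hy] at hy2
          have h1 : u y = w y := by
            rw [huD' y hy]
            rcases lt_max_iff.1 hy2 with h | h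
            · exact max_eq_left (by linarith)
            · linarith
          have h2 : ε < w y := by rw [← h1, huD' y hy]; exact hy2
          simp only [hv, h1, hw] at h2 ⊢
          exact max_eq_left (by linarith)
        have hfd : fderiv ℝ v x = fderiv ℝ φ x - fderiv ℝ ψ x := by
          rw [hev.fderiv_eq, fderiv_sub_const, fderiv_fun_sub dφ dψ]
        have hgd : gradient v x = gradient φ x - gradient ψ x := by
          simp only [gradient, hfd, map_sub]
        have := cp_pointwise hG hδ hG1 hG2 hG3 (gradient φ x) (gradient ψ x) (φ x) (ψ x) (v x) ε
          L M hε.le (hv0 x) (by rw [hev.eq_of_nhds]; ring)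
          (by rw [← hgd, hgn]; exact hfb x) (hvM x)
        rw [← hgd, hgn] at this
        exact this
      · have hvx : v x = 0 := max_eq_right (by linarith)
        have hfd : fderiv ℝ v x = 0 := IsLocalMin.fderiv_eq_zero
          (Eventually.of_forall fun y => by rw [hvx]; exact hv0 y)
        have hgd : gradient v x = 0 := by simp only [gradient, hfd, map_zero]
        rw [hvx, hfd, hgd]
        simp only [inner_zero_right, mul_zero, norm_zero]
        norm_num
        positivity)
    have e1 : ∫ x in D, ‖fderiv ℝ v x‖ ^ 2 = ∫ x, ‖fderiv ℝ v x‖ ^ 2 := by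
      refine setIntegral_eq_integral_of_forall_compl_eq_zero fun x hx => ?_
      rw [fderiv_of_notMem_tsupport ℝ (fun h => hx (hvs h))]; simp
    have e2 : ∫ x in D, v x ^ 2 = ∫ x, v x ^ 2 := by
      refine setIntegral_eq_integral_of_forall_compl_eq_zero fun x hx => ?_
      rw [image_eq_zero_of_notMem_tsupport (fun h => hx (hvs h))]; simp
    have P := cp_poincare (H := H) hvL hvc (fun x hx => hDs x (hvs (subset_tsupport v hx)))
    rw [integral_sub' i1 i2, integral_add' ((j1.const_mul _).add (j2.const_mul _))
      (integrable_const _), integral_add' (j1.const_mul _) (j2.const_mul _),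
      integral_const_mul, integral_const_mul, integral_const, e1, e2, smul_eq_mul,
      measureReal_restrict_apply_univ] at I3
    set Gv := ∫ x, ‖fderiv ℝ v x‖ ^ 2
    set V := ∫ x, v x ^ 2
    have hGv : 0 ≤ Gv := integral_nonneg fun x => by positivity
    have k1 : 0 ≤ -(bstar - 2 * δ) * Gv + 3 * δ * V + volume.real D * (ε * c) := by
      refine le_trans ?_ I3
      rw [I2]; linarith
    have k2 : bstar / 2 * Gv ≤ volume.real D * (ε * c) := by
      have q1 := mul_le_mul_of_nonneg_left P (by positivity : 0 ≤ 3 * δ)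
      have q2 := mul_le_mul_of_nonneg_right hδ0 hGv
      nlinarith
    have k3 : Gv ≤ 2 / bstar * (c * volume.real D) * ε := by
      have : Gv = 2 / bstar * (bstar / 2 * Gv) := by field_simp
      rw [this]
      calc _ ≤ 2 / bstar * (volume.real D * (ε * c)) :=
            mul_le_mul_of_nonneg_left k2 (by positivity)
        _ = _ := by ring
    calc V ≤ 4 * H ^ 2 * Gv := P
      _ ≤ 4 * H ^ 2 * (2 / bstar * (c * volume.real D) * ε) :=
          mul_le_mul_of_nonneg_left k3 (by positivity)
      _ = _ := by ring
  obtain ⟨C, hC⟩ := main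
  intro x₀ hx₀
  by_contra hlt
  push Not at hlt
  have hux₀ : 0 < u x₀ := by
    rw [huD' x₀ hx₀]; exact lt_max_of_lt_left (sub_pos.2 hlt)
  set a := u x₀ with ha
  set S : Set E2 := {x | a / 2 < u x} with hS
  have hSo : IsOpen S := isOpen_lt continuous_const huL.continuous
  have hSD : S ⊆ D := by
    intro x hx
    by_contra hxD
    simp only [hS, mem_ofPred_eq, huD x hxD] at hx
    linarith
  have hSf : volume S ≠ ⊤ := ((measure_mono hSD).trans_lt hfin).ne
  have hm : 0 < volume.real S := by
    refine ENNReal.toReal_pos (hSo.measure_pos volume ⟨x₀, ?_⟩).ne' hSf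
    simp only [hS, mem_ofPred_eq]; linarith
  set m := volume.real S
  have hC0 : 0 ≤ C := by
    have := hC 1 one_pos
    have h2 : 0 ≤ ∫ x, (max (u x - 1) 0) ^ 2 := integral_nonneg fun x => by positivity
    linarith
  have low : ∀ ε, 0 < ε → ε ≤ a / 4 → (a / 4) ^ 2 * m ≤ C * ε := by
    intro ε hε hεa
    refine le_trans ?_ (hC ε hε)
    have hint : Integrable (fun x => (max (u x - ε) 0) ^ 2) := by
      refine Continuous.integrable_of_hasCompactSupport
        (((huL.continuous.sub continuous_const).max continuous_const).pow 2) ?_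
      exact huc.comp_left (g := fun t : ℝ => (max (t - ε) 0) ^ 2) (by
        rw [max_eq_right (by linarith)]; norm_num)
    calc (a / 4) ^ 2 * m = ∫ x in S, (a / 4) ^ 2 := by
          rw [setIntegral_const, smul_eq_mul, mul_comm]
      _ ≤ ∫ x in S, (max (u x - ε) 0) ^ 2 := by
          refine setIntegral_mono_on (integrableOn_const hSf) hint.integrableOn hSo.measurableSet
            fun x hx => ?_
          simp only [hS, mem_ofPred_eq] at hx
          exact pow_le_pow_left₀ (by positivity) (le_max_of_le_left (by linarith)) 2
      _ ≤ _ := setIntegral_le_integral hint (Eventually.of_forall fun x => by positivity)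
  have ham : 0 < (a / 4) ^ 2 * m := by positivity
  have hε : 0 < min (a / 4) ((a / 4) ^ 2 * m / (2 * (C + 1))) :=
    lt_min (by positivity) (by positivity)
  have h1 := low _ hε (min_le_left _ _)
  have h2 : C * min (a / 4) ((a / 4) ^ 2 * m / (2 * (C + 1))) ≤ (a / 4) ^ 2 * m / 2 := by
    calc _ ≤ (C + 1) * ((a / 4) ^ 2 * m / (2 * (C + 1))) :=
          mul_le_mul (by linarith) (min_le_right _ _) hε.le (by linarith)
      _ = _ := by field_simp
  linarith
end
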